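/- arXiv:2410.22341 — 2 statements merged into one kernel-verified Lean document; each statement's English description precedes it below -/
import Mathlib

section
/- There is an absolute constant a > 0 such that for every expanding averaging system with degree d, Cheeger constant h, at most m connected components at each time, and every s ∈ (0,1], the maximum s-energy satisfies 𝓔^exp_{m,s} ≤ (a·d³·m·n/(h²·s))^m. -/
open scoped BigOperators ENNReal

/-- An expanding averaging system of degree `d` and Cheeger constant `h`:
`P t = (1/d)·M t` where `M t` is the 0/1 adjacency matrix of `G t` (self-loops
included, every vertex having degree exactly `d` counting its self-loop), and every
connected component of each `G t` is a `d`-regular expander with Cheeger constant `h`. -/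
structure ExpSystem (n d : ℕ) (h : ℝ) where
  M : ℕ → Matrix (Fin n) (Fin n) ℝ
  x : ℕ → Fin n → ℝ
  M_01 : ∀ t i j, M t i j = 0 ∨ M t i j = 1
  M_symm : ∀ t i j, M t i j = M t j i
  M_diag : ∀ t i, M t i i = 1
  M_deg : ∀ t i, ∑ j, M t i j = d
  /-- Cheeger-constant condition for every connected component: for every vertex `v`,
  every subset `X` of the connected component of `v` containing at most half of the
  component's vertices has at least `h·|X|` edges with exactly one endpoint in `X`. -/
  expander : ∀ t (v : Fin n) (X : Set (Fin n)),
    (∀ a ∈ X, Relation.ReflTransGen (fun b c => M t b c ≠ 0) v a) →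
    2 * X.ncard ≤ {a | Relation.ReflTransGen (fun b c => M t b c ≠ 0) v a}.ncard →
    h * X.ncard ≤
      ({e : Fin n × Fin n | e.1 ∈ X ∧ e.2 ∉ X ∧ e.1 ≠ e.2 ∧ M t e.1 e.2 ≠ 0}.ncard : ℝ)
  update : ∀ t i, x (t + 1) i = (1 / (d : ℝ)) * ∑ j, M t i j * x t j

/-- The union of the embedded edges of `G t` on the real line. -/
def ExpSystem.edgeUnion {n d : ℕ} {h : ℝ} (S : ExpSystem n d h) (t : ℕ) : Set ℝ :=
  ⋃ (i : Fin n) (j : Fin n) (_ : S.M t i j ≠ 0), Set.uIcc (S.x t i) (S.x t j)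

/-- The blocks of a union of embedded edges: its connected components. -/
def blockSet (U : Set ℝ) : Set (Set ℝ) :=
  {C | ∃ a ∈ U, C = connectedComponentIn U a}

/-- `E_{s,t}`: the sum of the `s`-th powers of the block lengths. -/
noncomputable def stepEnergy (s : ℝ) (U : Set ℝ) : ℝ≥0∞ :=
  ∑' C : blockSet U, ENNReal.ofReal (Metric.diam (C : Set ℝ) ^ s)

/-- The `s`-energy of an expanding averaging system. -/
noncomputable def ExpSystem.energy {n d : ℕ} {h : ℝ} (S : ExpSystem n d h) (s : ℝ) : ℝ≥0∞ :=
  ∑' t : ℕ, stepEnergy s (S.edgeUnion t)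

/-- Every graph `G t` of the system has at most `m` connected components. -/
def ExpSystem.componentsLE {n d : ℕ} {h : ℝ} (S : ExpSystem n d h) (m : ℕ) : Prop :=
  ∀ t : ℕ, ∃ c : Fin n → Fin m,
    (∀ i j, S.M t i j ≠ 0 → c i = c j) ∧
    (∀ i j, c i = c j → Relation.ReflTransGen (fun a b => S.M t a b ≠ 0) i j)

/-- Initial scaled variance at most one: `d·∑ i (x i − μ)² ≤ 1` with `μ = (1/n)∑ i x i`. -/
def ExpSystem.initVarLEOne {n d : ℕ} {h : ℝ} (S : ExpSystem n d h) : Prop :=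
  (d : ℝ) * ∑ i, (S.x 0 i - (∑ j, S.x 0 j) / n) ^ 2 ≤ 1


namespace EXS

lemma coarea {ι : Type*} [DecidableEq ι] (C : Finset ι) (M : ι → ι → ℝ) (h : ℝ)
    (hM : ∀ i j, 0 ≤ M i j)
    (hX : ∀ X ⊆ C, 2 * X.card ≤ C.card →
      h * X.card ≤ ∑ i ∈ C, ∑ j ∈ C, M i j * (if i ∈ X ∧ j ∉ X then 1 else 0)) :
    ∀ (N : ℕ) (f : ι → ℝ), (∀ i, 0 ≤ f i) → (C.filter (fun i => 0 < f i)).card ≤ N →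
      2 * (C.filter (fun i => 0 < f i)).card ≤ C.card →
      h * ∑ i ∈ C, f i ≤ ∑ i ∈ C, ∑ j ∈ C, M i j * max (f i - f j) 0 := by
  intro N
  induction N with
  | zero =>
    intro f hf h0 _
    have h1 : ∑ i ∈ C, f i = 0 := by
      apply Finset.sum_eq_zero
      intro i hi
      have : C.filter (fun i => 0 < f i) = ∅ := Finset.card_eq_zero.mp (by omega)
      by_contra hne
      have : i ∈ C.filter (fun i => 0 < f i) :=
        Finset.mem_filter.mpr ⟨hi, lt_of_le_of_ne (hf i) (Ne.symm hne)⟩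
      rw [‹C.filter (fun i => 0 < f i) = ∅›] at this
      exact absurd this (Finset.notMem_empty i)
    rw [h1, mul_zero]
    exact Finset.sum_nonneg fun i _ => Finset.sum_nonneg fun j _ =>
      mul_nonneg (hM i j) (le_max_right _ _)
  | succ N ih =>
    intro f hf h0 h2
    set X := C.filter (fun i => 0 < f i) with hXd
    by_cases hXe : X.Nonempty
    · obtain ⟨k, hk, hmin⟩ := Finset.exists_min_image X f hXe
      set ε := f k with hε
      have hkC : k ∈ C := (Finset.mem_filter.mp hk).1
      have hεp : 0 < ε := (Finset.mem_filter.mp hk).2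
      have hin : ∀ i ∈ X, ε ≤ f i := hmin
      have hout : ∀ i ∈ C, i ∉ X → f i = 0 := by
        intro i hi hiX
        by_contra hne
        exact hiX (Finset.mem_filter.mpr ⟨hi, lt_of_le_of_ne (hf i) (Ne.symm hne)⟩)
      set g : ι → ℝ := fun i => max (f i - ε) 0 with hg
      have hgin : ∀ i ∈ X, g i = f i - ε := fun i hi => max_eq_left (by linarith [hin i hi])
      have hgout : ∀ i ∈ C, i ∉ X → g i = 0 := fun i hi hiX => by
        simp only [hg]; rw [hout i hi hiX]; exact max_eq_right (by linarith)
      have hsub : C.filter (fun i => 0 < g i) ⊆ X.erase k := by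
        intro i hi
        obtain ⟨hiC, hip⟩ := Finset.mem_filter.mp hi
        have hiX : i ∈ X := by
          by_contra hc
          rw [hgout i hiC hc] at hip
          exact lt_irrefl _ hip
        refine Finset.mem_erase.mpr ⟨?_, hiX⟩
        rintro rfl
        rw [hgin i hiX] at hip
        linarith
      have hcard := Finset.card_le_card hsub
      rw [Finset.card_erase_of_mem hk] at hcard
      have hpos : 0 < X.card := Finset.card_pos.mpr hXe
      have ih' := ih g (fun i => le_max_right _ _) (by omega) (by omega)
      have hx := hX X (Finset.filter_subset _ _) h2
      have hs : ∑ i ∈ C, f i = ∑ i ∈ C, g i + ε * X.card := by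
        have : ∀ i ∈ C, f i = g i + (if i ∈ X then ε else 0) := by
          intro i hi
          by_cases hiX : i ∈ X
          · rw [hgin i hiX, if_pos hiX]; ring
          · rw [hgout i hi hiX, if_neg hiX, hout i hi hiX]; ring
        rw [Finset.sum_congr rfl this, Finset.sum_add_distrib]
        congr 1
        rw [← Finset.sum_filter, Finset.sum_const, nsmul_eq_mul, mul_comm]
        congr 3
        ext i
        simp only [Finset.mem_filter, hXd]
        tauto
      have hc : ∑ i ∈ C, ∑ j ∈ C, M i j * max (f i - f j) 0 =
          ∑ i ∈ C, ∑ j ∈ C, M i j * max (g i - g j) 0 +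
          ε * ∑ i ∈ C, ∑ j ∈ C, M i j * (if i ∈ X ∧ j ∉ X then 1 else 0) := by
        simp only [Finset.mul_sum]
        simp only [← Finset.sum_add_distrib]
        refine Finset.sum_congr rfl fun i hi => Finset.sum_congr rfl fun j hj => ?_
        by_cases hiX : i ∈ X <;> by_cases hjX : j ∈ X
        · rw [hgin i hiX, hgin j hjX]; simp [hjX]
        · rw [hgin i hiX, hgout j hj hjX, hout j hj hjX, max_eq_left (by linarith [hin i hiX]),
            max_eq_left (by linarith [hin i hiX])]
          simp [hiX, hjX]; ring
        · rw [hgin j hjX, hgout i hi hiX, hout i hi hiX, max_eq_right (by linarith [hin j hjX]),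
            max_eq_right (by linarith [hin j hjX])]
          simp [hiX]
        · rw [hgout i hi hiX, hout i hi hiX, hgout j hj hjX, hout j hj hjX]
          simp [hiX]
      rw [hs, hc]
      nlinarith
    · rw [Finset.not_nonempty_iff_eq_empty] at hXe
      apply ih f hf
      · rw [← hXd, hXe]; simp
      · exact h2

/-- one-sided Cheeger -/
lemma cheeger_one {ι : Type*} [DecidableEq ι] (C : Finset ι) (M : ι → ι → ℝ) (h d : ℝ) (hh : 0 < h)
    (hd : 0 < d)
    (hM : ∀ i j, 0 ≤ M i j) (hsymm : ∀ i j, M i j = M j i) (hdeg : ∀ i, ∑ j ∈ C, M i j ≤ d)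
    (hX : ∀ X ⊆ C, 2 * X.card ≤ C.card →
      h * X.card ≤ ∑ i ∈ C, ∑ j ∈ C, M i j * (if i ∈ X ∧ j ∉ X then 1 else 0))
    (x : ι → ℝ) (c : ℝ) (hc : 2 * (C.filter (fun i => c < x i)).card ≤ C.card)
    (k : ι) (hk : k ∈ C) (hkc : c ≤ x k) :
    h ^ 2 * (x k - c) ^ 2 ≤ 4 * d * ∑ i ∈ C, ∑ j ∈ C, M i j * (x i - x j) ^ 2 := by
  set y : ι → ℝ := fun i => max (x i - c) 0 with hy
  have hy0 : ∀ i, 0 ≤ y i := fun i => le_max_right _ _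
  set S := ∑ i ∈ C, y i ^ 2 with hS
  set Q := ∑ i ∈ C, ∑ j ∈ C, M i j * (x i - x j) ^ 2 with hQ
  have hfil : C.filter (fun i => 0 < y i ^ 2) = C.filter (fun i => c < x i) := by
    ext i
    simp only [Finset.mem_filter, and_congr_right_iff]
    intro _
    constructor
    · intro h1
      by_contra h2
      have : y i = 0 := max_eq_right (by linarith)
      rw [this] at h1; norm_num at h1
    · intro h1
      have : y i = x i - c := max_eq_left (by linarith)
      rw [this]
      have : 0 < x i - c := by linarith
      positivity
  have h1 := coarea C M h hM hX _ (fun i => y i ^ 2) (fun i => sq_nonneg _) le_rfl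
    (by rw [hfil]; exact hc)
  -- Cauchy-Schwarz
  have hQ0 : 0 ≤ Q := Finset.sum_nonneg fun i _ => Finset.sum_nonneg fun j _ =>
      mul_nonneg (hM i j) (sq_nonneg _)
  have hlip : ∀ i j, (y i - y j) ^ 2 ≤ (x i - x j) ^ 2 := by
    intro i j
    rw [sq_le_sq]
    have := abs_max_sub_max_le_abs (x i - c) (x j - c) 0
    simpa [hy] using this
  have hdeg2 : ∑ i ∈ C, ∑ j ∈ C, M i j * (y i + y j) ^ 2 ≤ 4 * d * S := by
    calc ∑ i ∈ C, ∑ j ∈ C, M i j * (y i + y j) ^ 2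
        ≤ ∑ i ∈ C, ∑ j ∈ C, (2 * (M i j * y i ^ 2) + 2 * (M i j * y j ^ 2)) := by
          refine Finset.sum_le_sum fun i _ => Finset.sum_le_sum fun j _ => ?_
          nlinarith [hM i j, mul_nonneg (hM i j) (sq_nonneg (y i - y j))]
      _ = 2 * ∑ i ∈ C, ∑ j ∈ C, M i j * y i ^ 2 + 2 * ∑ i ∈ C, ∑ j ∈ C, M i j * y j ^ 2 := by
          simp only [Finset.sum_add_distrib, Finset.mul_sum]
      _ = 4 * ∑ i ∈ C, ∑ j ∈ C, M i j * y i ^ 2 := by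
          have : ∑ i ∈ C, ∑ j ∈ C, M i j * y j ^ 2 = ∑ i ∈ C, ∑ j ∈ C, M i j * y i ^ 2 := by
            rw [Finset.sum_comm]
            exact Finset.sum_congr rfl fun i _ => Finset.sum_congr rfl fun j _ => by
              rw [hsymm]
          rw [this]; ring
      _ ≤ 4 * d * S := by
          have : ∑ i ∈ C, ∑ j ∈ C, M i j * y i ^ 2 ≤ d * S := by
            rw [hS, Finset.mul_sum]
            refine Finset.sum_le_sum fun i _ => ?_
            rw [← Finset.sum_mul]
            exact mul_le_mul_of_nonneg_right (hdeg i) (sq_nonneg _)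
          linarith
  -- AM-GM form: for every lam > 0
  have h2 : ∀ lam : ℝ, 0 < lam → 2 * lam * (h * S) ≤ Q + lam ^ 2 * (4 * d * S) := by
    intro lam hlam
    calc 2 * lam * (h * S)
        ≤ 2 * lam * ∑ i ∈ C, ∑ j ∈ C, M i j * max (y i ^ 2 - y j ^ 2) 0 :=
          mul_le_mul_of_nonneg_left h1 (by positivity)
      _ = ∑ i ∈ C, ∑ j ∈ C, 2 * lam * (M i j * max (y i ^ 2 - y j ^ 2) 0) := by
          simp only [Finset.mul_sum]
      _ ≤ ∑ i ∈ C, ∑ j ∈ C, (M i j * (x i - x j) ^ 2 + lam ^ 2 * (M i j * (y i + y j) ^ 2)) := by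
          refine Finset.sum_le_sum fun i _ => Finset.sum_le_sum fun j _ => ?_
          have hm : max (y i ^ 2 - y j ^ 2) 0 ≤ |y i - y j| * (y i + y j) := by
            apply max_le
            · have := le_abs_self (y i - y j)
              nlinarith [hy0 i, hy0 j]
            · exact mul_nonneg (abs_nonneg _) (add_nonneg (hy0 i) (hy0 j))
          have : 2 * lam * max (y i ^ 2 - y j ^ 2) 0 ≤ (x i - x j) ^ 2 + lam ^ 2 * (y i + y j) ^ 2 := by
            have h3 : 2 * lam * max (y i ^ 2 - y j ^ 2) 0 ≤ 2 * lam * (|y i - y j| * (y i + y j)) :=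
              mul_le_mul_of_nonneg_left hm (by positivity)
            nlinarith [sq_nonneg (|y i - y j| - lam * (y i + y j)), sq_abs (y i - y j), hlip i j]
          nlinarith [mul_le_mul_of_nonneg_left this (hM i j)]
      _ = Q + lam ^ 2 * ∑ i ∈ C, ∑ j ∈ C, M i j * (y i + y j) ^ 2 := by
          simp only [Finset.sum_add_distrib, Finset.mul_sum, hQ]
      _ ≤ Q + lam ^ 2 * (4 * d * S) := by
          have := mul_le_mul_of_nonneg_left hdeg2 (sq_nonneg lam)
          linarith
  have h3 := h2 (h / (4 * d)) (by positivity)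
  have h4 : h ^ 2 * S ≤ 4 * d * Q := by
    have e1 : 2 * (h / (4 * d)) * (h * S) = 2 * (h ^ 2 * S) / (4 * d) := by field_simp
    have e2 : (h / (4 * d)) ^ 2 * (4 * d * S) = (h ^ 2 * S) / (4 * d) := by field_simp
    rw [e1, e2] at h3
    have e3 : h ^ 2 * S / (4 * d) ≤ Q := by
      have : 2 * (h ^ 2 * S) / (4 * d) = h ^ 2 * S / (4 * d) + h ^ 2 * S / (4 * d) := by ring
      linarith
    rw [div_le_iff₀ (by positivity)] at e3
    linarith
  have h5 : (x k - c) ^ 2 ≤ S := by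
    have : y k = x k - c := max_eq_left (by linarith)
    rw [← this]
    exact Finset.single_le_sum (f := fun i => y i ^ 2) (fun i _ => sq_nonneg _) hk
  nlinarith [mul_le_mul_of_nonneg_left h5 (sq_nonneg h)]

lemma cheeger_two {ι : Type*} [DecidableEq ι] (C : Finset ι) (M : ι → ι → ℝ) (h d : ℝ) (hh : 0 < h)
    (hd : 0 < d)
    (hM : ∀ i j, 0 ≤ M i j) (hsymm : ∀ i j, M i j = M j i) (hdeg : ∀ i, ∑ j ∈ C, M i j ≤ d)
    (hX : ∀ X ⊆ C, 2 * X.card ≤ C.card →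
      h * X.card ≤ ∑ i ∈ C, ∑ j ∈ C, M i j * (if i ∈ X ∧ j ∉ X then 1 else 0))
    (x : ι → ℝ) (k l : ι) (hk : k ∈ C) (hl : l ∈ C) (hkl : x l ≤ x k) :
    h ^ 2 * (x k - x l) ^ 2 ≤ 16 * d * ∑ i ∈ C, ∑ j ∈ C, M i j * (x i - x j) ^ 2 := by
  set c := (x k + x l) / 2 with hcd
  have hdis : (C.filter (fun i => c < x i)).card + (C.filter (fun i => x i < c)).card ≤ C.card := by
    rw [← Finset.card_union_of_disjoint]
    · apply Finset.card_le_card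
      intro i hi
      simp only [Finset.mem_union, Finset.mem_filter] at hi
      tauto
    · rw [Finset.disjoint_left]
      intro i h1 h2
      have := (Finset.mem_filter.mp h1).2
      have := (Finset.mem_filter.mp h2).2
      linarith
  rcases Nat.le_total (C.filter (fun i => c < x i)).card (C.filter (fun i => x i < c)).card with h1 | h1
  · have := cheeger_one C M h d hh hd hM hsymm hdeg hX x c (by omega) k hk (by linarith)
    have e : x k - x l = 2 * (x k - c) := by rw [hcd]; ring
    rw [e]; nlinarith
  · have := cheeger_one C M h d hh hd hM hsymm hdeg hX (fun i => - x i) (-c)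
      (by simp only [neg_lt_neg_iff]; omega) l hl (by simp; linarith)
    have e : x k - x l = 2 * (- x l - -c) := by rw [hcd]; ring
    have e2 : ∀ i j, (- x i - - x j) ^ 2 = (x i - x j) ^ 2 := fun i j => by ring
    simp only [e2] at this
    rw [e]; nlinarith

end EXS

namespace EXS

variable {n d : ℕ} {h : ℝ}

open Classical in
noncomputable def cmp (S : ExpSystem n d h) (t : ℕ) (i : Fin n) : Finset (Fin n) :=
  Finset.univ.filter (fun j => Relation.ReflTransGen (fun a b => S.M t a b ≠ 0) i j)

noncomputable def cmps (S : ExpSystem n d h) (t : ℕ) (A : Finset (Fin n)) :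
    Finset (Finset (Fin n)) := A.image (cmp S t)

noncomputable def lo (S : ExpSystem n d h) (t : ℕ) (A : Finset (Fin n)) : ℝ :=
  sInf (S.x t '' (A : Set (Fin n)))

noncomputable def hi (S : ExpSystem n d h) (t : ℕ) (A : Finset (Fin n)) : ℝ :=
  sSup (S.x t '' (A : Set (Fin n)))

noncomputable def sp (S : ExpSystem n d h) (t : ℕ) (A : Finset (Fin n)) : ℝ :=
  hi S t A - lo S t A

def Cl (S : ExpSystem n d h) (t : ℕ) (A : Finset (Fin n)) : Prop :=
  ∀ i ∈ A, ∀ j, S.M t i j ≠ 0 → j ∈ A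

noncomputable def Wv (S : ExpSystem n d h) (t : ℕ) (A : Finset (Fin n)) : ℝ :=
  ∑ i ∈ A, (S.x t i - (∑ j ∈ A, S.x t j) / A.card) ^ 2

variable (S : ExpSystem n d h) (t : ℕ)

lemma mem_cmp {i j : Fin n} :
    j ∈ cmp S t i ↔ Relation.ReflTransGen (fun a b => S.M t a b ≠ 0) i j := by
  simp [cmp]

lemma self_mem_cmp (i : Fin n) : i ∈ cmp S t i := (mem_cmp S t).2 Relation.ReflTransGen.refl

lemma reach_symm {i j : Fin n} (hr : Relation.ReflTransGen (fun a b => S.M t a b ≠ 0) i j) :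
    Relation.ReflTransGen (fun a b => S.M t a b ≠ 0) j i := by
  induction hr with
  | refl => exact Relation.ReflTransGen.refl
  | tail _ hbc ih => exact Relation.ReflTransGen.head (by rw [S.M_symm]; exact hbc) ih

lemma cmp_eq {i j : Fin n} (hj : j ∈ cmp S t i) : cmp S t j = cmp S t i := by
  rw [mem_cmp] at hj
  ext k
  rw [mem_cmp, mem_cmp]
  exact ⟨fun hk => hj.trans hk, fun hk => (reach_symm S t hj).trans hk⟩

lemma cmp_edge {i j : Fin n} (hj : S.M t i j ≠ 0) : cmp S t j = cmp S t i :=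
  cmp_eq S t ((mem_cmp S t).2 (Relation.ReflTransGen.single hj))

lemma cmp_sub {A : Finset (Fin n)} (hA : Cl S t A) {i : Fin n} (hi : i ∈ A) : cmp S t i ⊆ A := by
  intro j hj
  rw [mem_cmp] at hj
  induction hj with
  | refl => exact hi
  | tail _ hbc ih => exact hA _ ih _ hbc

lemma lo_le {A : Finset (Fin n)} {i : Fin n} (hi : i ∈ A) : lo S t A ≤ S.x t i :=
  csInf_le ((A.finite_toSet.image _).bddBelow) ⟨i, hi, rfl⟩

lemma le_hi {A : Finset (Fin n)} {i : Fin n} (hi' : i ∈ A) : S.x t i ≤ hi S t A :=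
  le_csSup ((A.finite_toSet.image _).bddAbove) ⟨i, hi', rfl⟩

lemma exists_lo {A : Finset (Fin n)} (hA : A.Nonempty) : ∃ i ∈ A, S.x t i = lo S t A := by
  have : (S.x t '' (A : Set (Fin n))).Nonempty := (Finset.coe_nonempty.2 hA).image _
  exact this.csInf_mem (A.finite_toSet.image _)

lemma exists_hi {A : Finset (Fin n)} (hA : A.Nonempty) : ∃ i ∈ A, S.x t i = hi S t A := by
  have : (S.x t '' (A : Set (Fin n))).Nonempty := (Finset.coe_nonempty.2 hA).image _
  exact this.csSup_mem (A.finite_toSet.image _)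

lemma sp_nonneg (A : Finset (Fin n)) : 0 ≤ sp S t A := by
  rcases A.eq_empty_or_nonempty with rfl | ⟨i, hi⟩
  · simp [sp, EXS.hi, lo]
  · have := lo_le S t hi
    have := le_hi S t hi
    unfold sp; linarith

lemma M_nonneg (i j : Fin n) : 0 ≤ S.M t i j := by
  rcases S.M_01 t i j with h1 | h1 <;> rw [h1] <;> norm_num

lemma M_eq_ite (i j : Fin n) [Decidable (S.M t i j ≠ 0)] :
    S.M t i j = if S.M t i j ≠ 0 then 1 else 0 := by
  rcases S.M_01 t i j with h1 | h1
  · rw [if_neg (by simp [h1]), h1]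
  · rw [if_pos (by simp [h1]), h1]

lemma cmp_cheeger (v : Fin n) (X : Finset (Fin n)) (hX : X ⊆ cmp S t v)
    (h2 : 2 * X.card ≤ (cmp S t v).card) :
    h * X.card ≤ ∑ i ∈ cmp S t v, ∑ j ∈ cmp S t v,
      S.M t i j * (if i ∈ X ∧ j ∉ X then 1 else 0) := by
  classical
  have h1 := S.expander t v (X : Set (Fin n)) (fun a ha => (mem_cmp S t).1 (hX ha)) (by
    have : {a | Relation.ReflTransGen (fun b c => S.M t b c ≠ 0) v a} = (cmp S t v : Set (Fin n)) := by
      ext a; simp [mem_cmp]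
    rw [this, Set.ncard_coe_finset, Set.ncard_coe_finset]
    exact h2)
  rw [Set.ncard_coe_finset] at h1
  refine h1.trans ?_
  have e : {e : Fin n × Fin n | e.1 ∈ (X : Set (Fin n)) ∧ e.2 ∉ (X : Set (Fin n)) ∧ e.1 ≠ e.2 ∧ S.M t e.1 e.2 ≠ 0}
     ⊆ (((cmp S t v ×ˢ cmp S t v).filter (fun e => (e.1 ∈ X ∧ e.2 ∉ X) ∧ S.M t e.1 e.2 ≠ 0) : Finset (Fin n × Fin n)) : Set (Fin n × Fin n)) := by
    rintro ⟨a, b⟩ ⟨ha, hb, _, hab⟩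
    simp only [Finset.coe_filter, Finset.mem_product, Set.mem_ofPred_eq]
    have ha' := hX ha
    refine ⟨⟨ha', ?_⟩, ⟨ha, hb⟩, hab⟩
    rw [← cmp_eq S t ha', ← cmp_edge S t hab]
    exact self_mem_cmp S t b
  have e2 := Set.ncard_le_ncard e (Finset.finite_toSet _)
  rw [Set.ncard_coe_finset] at e2
  refine (Nat.cast_le.2 e2).trans ?_
  rw [Finset.card_filter, Finset.sum_product]
  push_cast
  refine Finset.sum_le_sum fun i _ => Finset.sum_le_sum fun j _ => ?_
  rcases S.M_01 t i j with h1 | h1 <;> simp [h1]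

lemma cmp_sp (hd : 1 ≤ d) (hh : 0 < h) (v : Fin n) :
    h ^ 2 * sp S t (cmp S t v) ^ 2 ≤
      16 * d * ∑ i ∈ cmp S t v, ∑ j ∈ cmp S t v, S.M t i j * (S.x t i - S.x t j) ^ 2 := by
  have hne : (cmp S t v).Nonempty := ⟨v, self_mem_cmp S t v⟩
  obtain ⟨l, hl, hl'⟩ := exists_lo S t hne
  obtain ⟨k, hk, hk'⟩ := exists_hi S t hne
  have := cheeger_two (cmp S t v) (S.M t) h d hh (by exact_mod_cast hd) (M_nonneg S t)
    (S.M_symm t) (fun i => by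
      rw [← S.M_deg t i]
      exact Finset.sum_le_sum_of_subset_of_nonneg (Finset.subset_univ _)
        (fun j _ _ => M_nonneg S t i j))
    (cmp_cheeger S t v) (S.x t) k l hk hl (by rw [hl']; exact lo_le S t hk)
  rw [hl', hk'] at this
  exact this

lemma sum_cl {A : Finset (Fin n)} (hA : Cl S t A) {i : Fin n} (hi : i ∈ A) (f : Fin n → ℝ) :
    ∑ j, S.M t i j * f j = ∑ j ∈ A, S.M t i j * f j := by
  symm
  apply Finset.sum_subset (Finset.subset_univ _)
  intro j _ hj
  have : S.M t i j = 0 := by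
    by_contra hc
    exact hj (hA i hi j hc)
  rw [this, zero_mul]

lemma sum_double {A : Finset (Fin n)} (hA : Cl S t A) (f : Fin n → ℝ) :
    ∑ i ∈ A, ∑ j ∈ A, S.M t i j * f j = d * ∑ j ∈ A, f j := by
  rw [Finset.sum_comm, Finset.mul_sum]
  refine Finset.sum_congr rfl fun j hj => ?_
  rw [← Finset.sum_mul]
  congr 1
  rw [← S.M_deg t j]
  have := sum_cl S t hA hj (fun _ => 1)
  simp only [mul_one] at this
  rw [this]
  exact Finset.sum_congr rfl fun i _ => S.M_symm t i j

lemma deg_cl {A : Finset (Fin n)} (hA : Cl S t A) {i : Fin n} (hi : i ∈ A) :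
    ∑ j ∈ A, S.M t i j = d := by
  have := sum_cl S t hA hi (fun _ => 1)
  simp only [mul_one] at this
  rw [← this, S.M_deg]

lemma upd_cl {A : Finset (Fin n)} (hA : Cl S t A) {i : Fin n} (hi : i ∈ A) :
    S.x (t+1) i = (1 / (d : ℝ)) * ∑ j ∈ A, S.M t i j * S.x t j := by
  rw [S.update, sum_cl S t hA hi]

lemma mean_cl (hd : 1 ≤ d) {A : Finset (Fin n)} (hA : Cl S t A) :
    ∑ i ∈ A, S.x (t+1) i = ∑ i ∈ A, S.x t i := by
  have hd' : (d : ℝ) ≠ 0 := by positivity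
  rw [Finset.sum_congr rfl fun i hi => upd_cl S t hA hi, ← Finset.mul_sum, sum_double S t hA]
  field_simp

/-- variance at a vertex -/
lemma drop_vertex (hd : 1 ≤ d) {A : Finset (Fin n)} (hA : Cl S t A) {i : Fin n} (hi : i ∈ A)
    (μ : ℝ) :
    (S.x (t+1) i - μ) ^ 2 + (1 / (2 * (d : ℝ) ^ 2)) * ∑ j ∈ A, S.M t i j * (S.x t i - S.x t j) ^ 2
      ≤ (1 / (d : ℝ)) * ∑ j ∈ A, S.M t i j * (S.x t j - μ) ^ 2 := by
  have hd' : (0 : ℝ) < d := by positivity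
  set p := S.x (t+1) i with hp
  have hsum : ∑ j ∈ A, S.M t i j * S.x t j = d * p := by
    rw [hp, upd_cl S t hA hi]; field_simp
  have hdg := deg_cl S t hA hi
  have e1 : ∀ c : ℝ, ∑ j ∈ A, S.M t i j * (S.x t j - c) ^ 2 =
      ∑ j ∈ A, S.M t i j * (S.x t j) ^ 2 - 2 * c * (d * p) + c ^ 2 * d := by
    intro c
    rw [← hsum, ← hdg, Finset.mul_sum, Finset.mul_sum, ← Finset.sum_sub_distrib,
      ← Finset.sum_add_distrib]
    exact Finset.sum_congr rfl fun j _ => by ring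
  have e2 := e1 μ
  have e3 := e1 p
  -- V = Σ M (x_j - p)^2
  have e4 : (S.x t i - p) ^ 2 ≤ ∑ j ∈ A, S.M t i j * (S.x t j - p) ^ 2 := by
    have := Finset.single_le_sum (f := fun j => S.M t i j * (S.x t j - p) ^ 2)
      (fun j _ => mul_nonneg (M_nonneg S t i j) (sq_nonneg _)) hi
    simpa [S.M_diag] using this
  have e6 : ∑ j ∈ A, S.M t i j * (S.x t i - S.x t j) ^ 2 =
      ∑ j ∈ A, S.M t i j * (S.x t j - p) ^ 2 + d * (S.x t i - p) ^ 2 := by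
    have := e1 (S.x t i)
    have e7 : ∑ j ∈ A, S.M t i j * (S.x t i - S.x t j) ^ 2 =
      ∑ j ∈ A, S.M t i j * (S.x t j - S.x t i) ^ 2 :=
      Finset.sum_congr rfl fun j _ => by ring
    rw [e7, this, e3]; ring
  set V := ∑ j ∈ A, S.M t i j * (S.x t j - p) ^ 2 with hV
  have hV0 : 0 ≤ V := le_trans (sq_nonneg _) e4
  have hd1 : (1 : ℝ) ≤ d := by exact_mod_cast hd
  rw [e6]
  have e8 : ∑ j ∈ A, S.M t i j * (S.x t j - μ) ^ 2 = V + d * (p - μ) ^ 2 := by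
    rw [e2, e3]; ring
  rw [e8]
  have e9 : 1 / (2 * (d : ℝ) ^ 2) * (V + d * (S.x t i - p) ^ 2) ≤ 1 / (d : ℝ) * V := by
    have : V + d * (S.x t i - p) ^ 2 ≤ 2 * d * V := by nlinarith
    calc 1 / (2 * (d : ℝ) ^ 2) * (V + d * (S.x t i - p) ^ 2)
        ≤ 1 / (2 * (d : ℝ) ^ 2) * (2 * d * V) := mul_le_mul_of_nonneg_left this (by positivity)
      _ = 1 / (d : ℝ) * V := by field_simp
  have e10 : 1 / (d : ℝ) * (V + d * (p - μ) ^ 2) = 1 / (d : ℝ) * V + (p - μ) ^ 2 := by field_simp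
  linarith

lemma drop_step (hd : 1 ≤ d) {A : Finset (Fin n)} (hA : Cl S t A) :
    Wv S (t+1) A + (1 / (2 * (d : ℝ) ^ 2)) * ∑ i ∈ A, ∑ j ∈ A, S.M t i j * (S.x t i - S.x t j) ^ 2
      ≤ Wv S t A := by
  unfold Wv
  rw [mean_cl S t hd hA]
  set μ := (∑ i ∈ A, S.x t i) / A.card
  have h1 := Finset.sum_le_sum fun i (hi : i ∈ A) => drop_vertex S t hd hA hi μ
  rw [Finset.sum_add_distrib, ← Finset.mul_sum, ← Finset.mul_sum,
    sum_double S t hA (fun j => (S.x t j - μ) ^ 2)] at h1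
  have hd' : (d : ℝ) ≠ 0 := by positivity
  have : 1 / (d : ℝ) * (d * ∑ j ∈ A, (S.x t j - μ) ^ 2) = ∑ j ∈ A, (S.x t j - μ) ^ 2 := by
    field_simp
  linarith

lemma sum_cmps {A : Finset (Fin n)} (hA : Cl S t A) :
    ∑ C ∈ cmps S t A, ∑ i ∈ C, ∑ j ∈ C, S.M t i j * (S.x t i - S.x t j) ^ 2
      ≤ ∑ i ∈ A, ∑ j ∈ A, S.M t i j * (S.x t i - S.x t j) ^ 2 := by
  have h1 : ∑ i ∈ A, ∑ j ∈ A, S.M t i j * (S.x t i - S.x t j) ^ 2 =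
      ∑ C ∈ cmps S t A, ∑ i ∈ A with cmp S t i = C, ∑ j ∈ A, S.M t i j * (S.x t i - S.x t j) ^ 2 :=
    (Finset.sum_fiberwise_of_maps_to (fun i hi => Finset.mem_image_of_mem _ hi) _).symm
  rw [h1]
  refine Finset.sum_le_sum fun C hC => ?_
  obtain ⟨v, hv, rfl⟩ := Finset.mem_image.1 hC
  have hsub := cmp_sub S t hA hv
  have : (A.filter fun i => cmp S t i = cmp S t v) = cmp S t v := by
    ext i
    rw [Finset.mem_filter]
    exact ⟨fun hi => hi.2 ▸ self_mem_cmp S t i, fun hi => ⟨hsub hi, cmp_eq S t hi⟩⟩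
  rw [this]
  exact Finset.sum_le_sum fun i _ => Finset.sum_le_sum_of_subset_of_nonneg hsub
    (fun j _ _ => mul_nonneg (M_nonneg S t i j) (sq_nonneg _))

lemma drop_main (hd : 1 ≤ d) (hh : 0 < h) {A : Finset (Fin n)} (hA : Cl S t A) :
    Wv S (t+1) A + (h ^ 2 / (32 * (d : ℝ) ^ 3)) * ∑ C ∈ cmps S t A, sp S t C ^ 2 ≤ Wv S t A := by
  have hd' : (0 : ℝ) < d := by positivity
  have h1 := drop_step S t hd hA
  have h2 := sum_cmps S t hA
  have h3 : h ^ 2 * ∑ C ∈ cmps S t A, sp S t C ^ 2 ≤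
    16 * d * ∑ C ∈ cmps S t A, ∑ i ∈ C, ∑ j ∈ C, S.M t i j * (S.x t i - S.x t j) ^ 2 := by
    rw [Finset.mul_sum, Finset.mul_sum]
    refine Finset.sum_le_sum fun C hC => ?_
    obtain ⟨v, hv, rfl⟩ := Finset.mem_image.1 hC
    exact cmp_sp S t hd hh v
  set Q := ∑ i ∈ A, ∑ j ∈ A, S.M t i j * (S.x t i - S.x t j) ^ 2
  have h4 : h ^ 2 * ∑ C ∈ cmps S t A, sp S t C ^ 2 ≤ 16 * d * Q :=
    h3.trans (mul_le_mul_of_nonneg_left h2 (by positivity))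
  have h5 : (h ^ 2 / (32 * (d : ℝ) ^ 3)) * ∑ C ∈ cmps S t A, sp S t C ^ 2 ≤ 1 / (2 * (d : ℝ) ^ 2) * Q := by
    calc (h ^ 2 / (32 * (d : ℝ) ^ 3)) * ∑ C ∈ cmps S t A, sp S t C ^ 2
        = (h ^ 2 * ∑ C ∈ cmps S t A, sp S t C ^ 2) / (32 * (d : ℝ) ^ 3) := by ring
      _ ≤ (16 * d * Q) / (32 * (d : ℝ) ^ 3) := by gcongr
      _ = 1 / (2 * (d : ℝ) ^ 2) * Q := by field_simp; ring
  linarith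

lemma Wv_nonneg (A : Finset (Fin n)) : 0 ≤ Wv S t A :=
  Finset.sum_nonneg fun _ _ => sq_nonneg _

lemma Wv_le (A : Finset (Fin n)) : Wv S t A ≤ n * sp S t A ^ 2 := by
  rcases A.eq_empty_or_nonempty with rfl | hA
  · simp only [Wv, Finset.sum_empty]; positivity
  have hc : (0 : ℝ) < A.card := by exact_mod_cast hA.card_pos
  have h1 : ∀ i ∈ A, (S.x t i - (∑ j ∈ A, S.x t j) / A.card) ^ 2 ≤ sp S t A ^ 2 := by
    intro i hi
    have h2 : (∑ j ∈ A, S.x t j) / A.card ≤ EXS.hi S t A := by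
      rw [div_le_iff₀ hc, mul_comm, ← nsmul_eq_mul]
      exact Finset.sum_le_card_nsmul _ _ _ fun j hj => le_hi S t hj
    have h3 : lo S t A ≤ (∑ j ∈ A, S.x t j) / A.card := by
      rw [le_div_iff₀ hc, mul_comm, ← nsmul_eq_mul]
      exact Finset.card_nsmul_le_sum _ _ _ fun j hj => lo_le S t hj
    have := lo_le S t hi
    have := le_hi S t hi
    apply sq_le_sq'
    · unfold sp; linarith
    · unfold sp; linarith
  calc Wv S t A ≤ ∑ i ∈ A, sp S t A ^ 2 := Finset.sum_le_sum h1
    _ = A.card * sp S t A ^ 2 := by simp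
    _ ≤ n * sp S t A ^ 2 := by
      apply mul_le_mul_of_nonneg_right _ (sq_nonneg _)
      have := Finset.card_le_univ A
      simp at this
      exact_mod_cast this

lemma sum_sq_min (B : Finset (Fin n)) (f : Fin n → ℝ) (c : ℝ) :
    ∑ i ∈ B, (f i - (∑ j ∈ B, f j) / B.card) ^ 2 ≤ ∑ i ∈ B, (f i - c) ^ 2 := by
  rcases B.eq_empty_or_nonempty with rfl | hB
  · simp
  have hc : (0 : ℝ) < B.card := by exact_mod_cast hB.card_pos
  set μ := (∑ j ∈ B, f j) / B.card with hμ
  have hs : ∑ j ∈ B, f j = B.card * μ := by rw [hμ]; field_simp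
  have e : ∀ c : ℝ, ∑ i ∈ B, (f i - c) ^ 2 = ∑ i ∈ B, f i ^ 2 - 2 * c * (B.card * μ) + B.card * c ^ 2 := by
    intro c
    have : (B.card : ℝ) * c ^ 2 = ∑ i ∈ B, c ^ 2 := by simp
    rw [this, ← hs, Finset.mul_sum, ← Finset.sum_sub_distrib, ← Finset.sum_add_distrib]
    exact Finset.sum_congr rfl fun j _ => by ring
  rw [e, e]
  nlinarith [mul_nonneg hc.le (sq_nonneg (μ - c))]

lemma Wv_mono {A B : Finset (Fin n)} (hB : B ⊆ A) : Wv S t B ≤ Wv S t A :=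
  (sum_sq_min B (S.x t) _).trans
    (Finset.sum_le_sum_of_subset_of_nonneg hB fun _ _ _ => sq_nonneg _)

lemma sp_le {A C : Finset (Fin n)} (hC : C ⊆ A) : sp S t C ^ 2 ≤ 2 * Wv S t A := by
  refine le_trans ?_ (mul_le_mul_of_nonneg_left (Wv_mono S t hC) (by norm_num))
  rcases C.eq_empty_or_nonempty with rfl | hne
  · simp [sp, EXS.hi, lo, Wv]
  obtain ⟨l, hl, hl'⟩ := exists_lo S t hne
  obtain ⟨k, hk, hk'⟩ := exists_hi S t hne
  unfold sp
  rw [← hl', ← hk']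
  by_cases hkl : k = l
  · subst hkl
    have := Wv_nonneg S t C
    simp; linarith
  · unfold Wv
    set μ := (∑ j ∈ C, S.x t j) / C.card
    have : ∑ i ∈ {k, l}, (S.x t i - μ) ^ 2 ≤ ∑ i ∈ C, (S.x t i - μ) ^ 2 :=
      Finset.sum_le_sum_of_subset_of_nonneg (by
        intro i hi; simp at hi; rcases hi with rfl | rfl <;> assumption) fun _ _ _ => sq_nonneg _
    rw [Finset.sum_pair hkl] at this
    nlinarith [sq_nonneg (S.x t k - μ + (S.x t l - μ))]

end EXS

namespace EXS

variable {n d : ℕ} {h : ℝ}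

noncomputable def en (S : ExpSystem n d h) (s : ℝ) (t : ℕ) (A : Finset (Fin n)) : ℝ :=
  ∑ C ∈ cmps S t A, sp S t C ^ s

variable (S : ExpSystem n d h)

lemma cmps_split (t : ℕ) {L R : Finset (Fin n)} (hR : Cl S t R) (hdis : Disjoint L R) :
    Disjoint (cmps S t L) (cmps S t R) := by
  rw [Finset.disjoint_left]
  intro C h1 h2
  obtain ⟨i, hi, rfl⟩ := Finset.mem_image.1 h1
  obtain ⟨j, hj, hij⟩ := Finset.mem_image.1 h2
  have : i ∈ cmp S t j := by rw [hij]; exact self_mem_cmp S t i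
  exact Finset.disjoint_left.1 hdis hi (cmp_sub S t hR hj this)

lemma cmps_union (t : ℕ) (L R : Finset (Fin n)) : cmps S t (L ∪ R) = cmps S t L ∪ cmps S t R :=
  Finset.image_union _ _

lemma en_split (s : ℝ) (t : ℕ) {L R : Finset (Fin n)} (hR : Cl S t R) (hdis : Disjoint L R) :
    en S s t (L ∪ R) = en S s t L + en S s t R := by
  unfold en
  rw [cmps_union, Finset.sum_union (cmps_split S t hR hdis)]

lemma card_split (t : ℕ) {L R : Finset (Fin n)} (hR : Cl S t R) (hdis : Disjoint L R) :
    (cmps S t (L ∪ R)).card = (cmps S t L).card + (cmps S t R).card := by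
  rw [cmps_union, Finset.card_union_of_disjoint (cmps_split S t hR hdis)]

lemma en_le {s : ℝ} (hs : 0 < s) (hs1 : s ≤ 1) (t : ℕ) {A : Finset (Fin n)} (hA : Cl S t A) {k : ℕ}
    (hk : (cmps S t A).card ≤ k) : en S s t A ≤ 2 * k * Wv S t A ^ (s / 2) := by
  have hW := Wv_nonneg S t A
  have h1 : ∀ C ∈ cmps S t A, sp S t C ^ s ≤ 2 * Wv S t A ^ (s / 2) := by
    intro C hC
    obtain ⟨v, hv, rfl⟩ := Finset.mem_image.1 hC
    have h2 := sp_le S t (cmp_sub S t hA hv)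
    have h3 := sp_nonneg S t (cmp S t v)
    calc sp S t (cmp S t v) ^ s = (sp S t (cmp S t v) ^ 2) ^ (s / 2) := by
          rw [← Real.rpow_natCast, ← Real.rpow_mul h3]; congr 1; push_cast; ring
      _ ≤ (2 * Wv S t A) ^ (s / 2) := Real.rpow_le_rpow (sq_nonneg _) h2 (by linarith)
      _ = 2 ^ (s / 2) * Wv S t A ^ (s / 2) := Real.mul_rpow (by norm_num) hW
      _ ≤ 2 * Wv S t A ^ (s / 2) := by
          apply mul_le_mul_of_nonneg_right _ (Real.rpow_nonneg hW _)
          calc (2 : ℝ) ^ (s / 2) ≤ 2 ^ (1 : ℝ) :=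
                Real.rpow_le_rpow_of_exponent_le (by norm_num) (by linarith)
            _ = 2 := Real.rpow_one 2
  have h4 := Finset.sum_le_card_nsmul _ _ _ h1
  rw [nsmul_eq_mul] at h4
  have h5 : ((cmps S t A).card : ℝ) ≤ k := by exact_mod_cast hk
  have h6 : 0 ≤ 2 * Wv S t A ^ (s / 2) := by positivity
  unfold en
  nlinarith [mul_le_mul_of_nonneg_right h5 h6]

lemma drop_sum (hd : 1 ≤ d) (hh : 0 < h) {A : Finset (Fin n)} (t0 : ℕ) : ∀ N : ℕ,
    (∀ t, t0 ≤ t → t < t0 + N → Cl S t A) →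
    Wv S (t0 + N) A + (h ^ 2 / (32 * (d : ℝ) ^ 3)) *
      ∑ t ∈ Finset.Ico t0 (t0 + N), ∑ C ∈ cmps S t A, sp S t C ^ 2 ≤ Wv S t0 A := by
  intro N
  induction N with
  | zero => intro _; simp
  | succ N ih =>
    intro hA
    have h1 := ih fun t h1 h2 => hA t h1 (by omega)
    have h2 := drop_main S (t0 + N) hd hh (hA (t0 + N) (by omega) (by omega))
    rw [← add_assoc, Finset.sum_Ico_succ_top (by omega), mul_add]
    linarith

lemma Wv_anti (hd : 1 ≤ d) (hh : 0 < h) {A : Finset (Fin n)} (t0 : ℕ) (N : ℕ)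
    (hA : ∀ t, t0 ≤ t → t < t0 + N → Cl S t A) : Wv S (t0 + N) A ≤ Wv S t0 A := by
  have h1 := drop_sum S hd hh t0 N hA
  have h2 : 0 ≤ (h ^ 2 / (32 * (d : ℝ) ^ 3)) *
      ∑ t ∈ Finset.Ico t0 (t0 + N), ∑ C ∈ cmps S t A, sp S t C ^ 2 :=
    mul_nonneg (by positivity) (Finset.sum_nonneg fun _ _ => Finset.sum_nonneg fun _ _ => sq_nonneg _)
  linarith

lemma stay_le (hd : 1 ≤ d) {L : Finset (Fin n)} (t0 : ℕ) (b : ℝ) : ∀ N : ℕ,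
    (∀ t, t0 ≤ t → t < t0 + N → Cl S t L) → (∀ i ∈ L, S.x t0 i ≤ b) →
    ∀ i ∈ L, S.x (t0 + N) i ≤ b := by
  intro N
  induction N with
  | zero => intro _ h1; simpa using h1
  | succ N ih =>
    intro hA h1 i hi
    have h2 := ih (fun t h1 h2 => hA t h1 (by omega)) h1
    have hc := hA (t0 + N) (by omega) (by omega)
    have hd' : (0 : ℝ) < d := by positivity
    rw [← add_assoc, upd_cl S _ hc hi, one_div, inv_mul_le_iff₀ hd', ← deg_cl S _ hc hi,
      Finset.sum_mul]
    exact Finset.sum_le_sum fun j hj => mul_le_mul_of_nonneg_left (h2 j hj) (M_nonneg S _ _ _)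

lemma stay_ge (hd : 1 ≤ d) {L : Finset (Fin n)} (t0 : ℕ) (b : ℝ) : ∀ N : ℕ,
    (∀ t, t0 ≤ t → t < t0 + N → Cl S t L) → (∀ i ∈ L, b ≤ S.x t0 i) →
    ∀ i ∈ L, b ≤ S.x (t0 + N) i := by
  intro N
  induction N with
  | zero => intro _ h1; simpa using h1
  | succ N ih =>
    intro hA h1 i hi
    have h2 := ih (fun t h1 h2 => hA t h1 (by omega)) h1
    have hc := hA (t0 + N) (by omega) (by omega)
    have hd' : (0 : ℝ) < d := by positivity
    rw [← add_assoc, upd_cl S _ hc hi, one_div, le_inv_mul_iff₀ hd', ← deg_cl S _ hc hi,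
      Finset.sum_mul]
    exact Finset.sum_le_sum fun j hj => mul_le_mul_of_nonneg_left (h2 j hj) (M_nonneg S _ _ _)

noncomputable def Lc (t0 : ℕ) (A : Finset (Fin n)) (b : ℝ) : Finset (Fin n) :=
  A.filter fun i => S.x t0 i ≤ b

noncomputable def Rc (t0 : ℕ) (A : Finset (Fin n)) (b : ℝ) : Finset (Fin n) :=
  A.filter fun i => b < S.x t0 i

def Crs (t0 : ℕ) (A : Finset (Fin n)) (b : ℝ) (t : ℕ) : Prop :=
  ∃ i ∈ Lc S t0 A b, ∃ j ∈ Rc S t0 A b, S.M t i j ≠ 0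

lemma LR_union (t0 : ℕ) (A : Finset (Fin n)) (b : ℝ) : Lc S t0 A b ∪ Rc S t0 A b = A := by
  ext i
  simp only [Lc, Rc, Finset.mem_union, Finset.mem_filter]
  have := le_or_gt (S.x t0 i) b
  tauto

lemma LR_disj (t0 : ℕ) (A : Finset (Fin n)) (b : ℝ) : Disjoint (Lc S t0 A b) (Rc S t0 A b) := by
  rw [Finset.disjoint_left]
  intro i h1 h2
  have := (Finset.mem_filter.1 h1).2
  have := (Finset.mem_filter.1 h2).2
  linarith

lemma cl_L (t0 : ℕ) {A : Finset (Fin n)} (b : ℝ) {t : ℕ} (hA : Cl S t A) (hc : ¬ Crs S t0 A b t) :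
    Cl S t (Lc S t0 A b) := by
  intro i hi j hj
  have hjA := hA i (Finset.mem_filter.1 hi).1 j hj
  rw [← LR_union S t0 A b, Finset.mem_union] at hjA
  exact hjA.resolve_right fun hjR => hc ⟨i, hi, j, hjR, hj⟩

lemma cl_R (t0 : ℕ) {A : Finset (Fin n)} (b : ℝ) {t : ℕ} (hA : Cl S t A) (hc : ¬ Crs S t0 A b t) :
    Cl S t (Rc S t0 A b) := by
  intro i hi j hj
  have hjA := hA i (Finset.mem_filter.1 hi).1 j hj
  rw [← LR_union S t0 A b, Finset.mem_union] at hjA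
  exact hjA.resolve_left fun hjL => hc ⟨j, hjL, i, hi, by rw [S.M_symm]; exact hj⟩

lemma gap_cover (hd : 1 ≤ d) (t0 T : ℕ) {A : Finset (Fin n)} (b : ℝ)
    (hA : ∀ t, t0 ≤ t → t < T → Cl S t A)
    (hc : ∃ t, t0 ≤ t ∧ t < T ∧ Crs S t0 A b t) :
    ∃ t, t0 ≤ t ∧ t < T ∧ ∃ C ∈ cmps S t A, lo S t C ≤ b ∧ lo S t0 (Rc S t0 A b) ≤ hi S t C := by
  classical
  have hex : ∃ u, t0 ≤ u ∧ Crs S t0 A b u := by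
    obtain ⟨t, h1, _, h3⟩ := hc
    exact ⟨t, h1, h3⟩
  obtain ⟨u0, hu01, hu02, hu03⟩ := hc
  obtain ⟨h1, i, hi, j, hj, hij⟩ := Nat.find_spec hex
  have hmin : ∀ t, t0 ≤ t → t < Nat.find hex → ¬ Crs S t0 A b t := fun t h1 h2 h3 =>
    Nat.find_min hex h2 ⟨h1, h3⟩
  have hle : Nat.find hex ≤ u0 := Nat.find_min' hex ⟨hu01, hu03⟩
  set u := Nat.find hex
  obtain ⟨N, hN⟩ := Nat.exists_eq_add_of_le h1
  have hiA := (Finset.mem_filter.1 hi).1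
  refine ⟨u, h1, by omega, cmp S u i, Finset.mem_image_of_mem _ hiA, ?_, ?_⟩
  · refine (lo_le S u (self_mem_cmp S u i)).trans ?_
    rw [hN]
    exact stay_le S hd t0 b N
      (fun t h2 h3 => cl_L S t0 b (hA t h2 (by omega)) (hmin t h2 (by omega)))
      (fun i hi => (Finset.mem_filter.1 hi).2) i hi
  · have hj' : j ∈ cmp S u i := by rw [← cmp_edge S u hij]; exact self_mem_cmp S u j
    refine le_trans ?_ (le_hi S u hj')
    rw [hN]
    exact stay_ge S hd t0 _ N
      (fun t h2 h3 => cl_R S t0 b (hA t h2 (by omega)) (hmin t h2 (by omega)))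
      (fun i hi => lo_le S t0 hi) j hj

lemma phase_cover (hd : 1 ≤ d) (t0 T : ℕ) (hT : t0 < T) {A : Finset (Fin n)} (hne : A.Nonempty)
    (hA : ∀ t, t0 ≤ t → t < T → Cl S t A) {k : ℕ} (hk : (cmps S t0 A).card ≤ k)
    (hc : ∀ C ∈ cmps S t0 A, (Rc S t0 A (hi S t0 C)).Nonempty →
      ∃ t, t0 ≤ t ∧ t < T ∧ Crs S t0 A (hi S t0 C) t) :
    sp S t0 A ^ 2 ≤ 2 * k * ∑ t ∈ Finset.Ico t0 T, ∑ C ∈ cmps S t A, sp S t C ^ 2 := by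
  classical
  have hphi : ∀ C : Finset (Fin n), ∃ p : (Σ _ : ℕ, Finset (Fin n)), C ∈ cmps S t0 A →
      (p ∈ (Finset.Ico t0 T).sigma (fun t => cmps S t A) ∧
      ((Rc S t0 A (hi S t0 C)).Nonempty → lo S p.1 p.2 ≤ hi S t0 C ∧
        lo S t0 (Rc S t0 A (hi S t0 C)) ≤ hi S p.1 p.2)) := by
    intro C
    by_cases hC : C ∈ cmps S t0 A
    · by_cases hR : (Rc S t0 A (hi S t0 C)).Nonempty
      · obtain ⟨t, h1, h2, C', h3, h4, h5⟩ := gap_cover S hd t0 T _ hA (hc C hC hR)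
        exact ⟨⟨t, C'⟩, fun _ => ⟨by simp [h1, h2, h3], fun _ => ⟨h4, h5⟩⟩⟩
      · exact ⟨⟨t0, C⟩, fun _ => ⟨by simp [hT, hC], fun hR' => absurd hR' hR⟩⟩
    · exact ⟨⟨t0, C⟩, fun h => absurd h hC⟩
  choose φ hφ using hphi
  set F : Finset (Σ _ : ℕ, Finset (Fin n)) :=
    (cmps S t0 A).image (fun C => ⟨t0, C⟩) ∪ (cmps S t0 A).image φ with hF
  have hFc : F.card ≤ 2 * k := by
    refine (Finset.card_union_le _ _).trans ?_
    have h1 := Finset.card_image_le (s := cmps S t0 A)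
      (f := fun C => (⟨t0, C⟩ : Σ _ : ℕ, Finset (Fin n)))
    have h2 := Finset.card_image_le (s := cmps S t0 A) (f := φ)
    omega
  have hFs : F ⊆ (Finset.Ico t0 T).sigma (fun t => cmps S t A) := by
    intro p hp
    rcases Finset.mem_union.1 hp with hp | hp
    · obtain ⟨C, hC, rfl⟩ := Finset.mem_image.1 hp
      simp [hT, hC]
    · obtain ⟨C, hC, rfl⟩ := Finset.mem_image.1 hp
      exact (hφ C hC).1
  have hcov : Set.Icc (lo S t0 A) (hi S t0 A) ⊆ ⋃ p ∈ F, Set.Icc (lo S p.1 p.2) (hi S p.1 p.2) := by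
    intro z hz
    obtain ⟨l, hl, hl'⟩ := exists_lo S t0 hne
    obtain ⟨k', hk1, hk2⟩ := exists_hi S t0 hne
    have hB : (A.filter fun i => S.x t0 i ≤ z).Nonempty :=
      ⟨l, Finset.mem_filter.2 ⟨hl, by rw [hl']; exact hz.1⟩⟩
    obtain ⟨i, hi1, hi2⟩ := Finset.exists_max_image _ (S.x t0) hB
    obtain ⟨hiA, hiz⟩ := Finset.mem_filter.1 hi1
    have hC : cmp S t0 i ∈ cmps S t0 A := Finset.mem_image_of_mem _ hiA
    simp only [Set.mem_iUnion]
    by_cases hb : z ≤ hi S t0 (cmp S t0 i)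
    · refine ⟨⟨t0, cmp S t0 i⟩, Finset.mem_union_left _ (Finset.mem_image_of_mem _ hC), ?_, hb⟩
      exact (lo_le S t0 (self_mem_cmp S t0 i)).trans hiz
    · push Not at hb
      have hxb := le_hi S t0 (self_mem_cmp S t0 i)
      obtain ⟨hp, hR⟩ := hφ _ hC
      have hRn : (Rc S t0 A (hi S t0 (cmp S t0 i))).Nonempty :=
        ⟨k', Finset.mem_filter.2 ⟨hk1, by rw [hk2]; exact lt_of_lt_of_le hb hz.2⟩⟩
      obtain ⟨h1, h2⟩ := hR hRn
      refine ⟨φ (cmp S t0 i), Finset.mem_union_right _ (Finset.mem_image_of_mem _ hC), h1.trans hb.le, le_trans ?_ h2⟩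
      obtain ⟨r, hr1, hr2⟩ := exists_lo S t0 hRn
      rw [← hr2]
      obtain ⟨hrA, hrb⟩ := Finset.mem_filter.1 hr1
      by_contra hc
      push Not at hc
      have := hi2 r (Finset.mem_filter.2 ⟨hrA, hc.le⟩)
      linarith
  have hD : sp S t0 A ≤ ∑ p ∈ F, sp S p.1 p.2 := by
    have h1 := (MeasureTheory.measure_mono (μ := MeasureTheory.volume) hcov).trans
      (MeasureTheory.measure_biUnion_finset_le F _)
    simp only [Real.volume_Icc] at h1
    rw [← ENNReal.ofReal_sum_of_nonneg (fun p _ => sp_nonneg S p.1 p.2)] at h1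
    exact (ENNReal.ofReal_le_ofReal_iff (Finset.sum_nonneg fun p _ => sp_nonneg S p.1 p.2)).1 h1
  have h2 : ∑ p ∈ F, sp S p.1 p.2 ^ 2 ≤ ∑ t ∈ Finset.Ico t0 T, ∑ C ∈ cmps S t A, sp S t C ^ 2 := by
    rw [← Finset.sum_sigma (Finset.Ico t0 T) (fun t => cmps S t A) (fun p => sp S p.1 p.2 ^ 2)]
    exact Finset.sum_le_sum_of_subset_of_nonneg hFs fun _ _ _ => sq_nonneg _
  have h3 := sq_sum_le_card_mul_sum_sq (s := F) (f := fun p => sp S p.1 p.2)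
  have h4 : (F.card : ℝ) ≤ 2 * k := by exact_mod_cast hFc
  calc sp S t0 A ^ 2 ≤ (∑ p ∈ F, sp S p.1 p.2) ^ 2 := pow_le_pow_left₀ (sp_nonneg S t0 A) hD 2
    _ ≤ F.card * ∑ p ∈ F, sp S p.1 p.2 ^ 2 := h3
    _ ≤ 2 * k * ∑ t ∈ Finset.Ico t0 T, ∑ C ∈ cmps S t A, sp S t C ^ 2 :=
      mul_le_mul h4 h2 (Finset.sum_nonneg fun _ _ => sq_nonneg _) (by positivity)

end EXS

namespace EXS

variable {n d : ℕ} {h : ℝ}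

lemma final_arith {s K B m W W' p θ E1 E2 E3 : ℝ} (hp : p = s / 2) (hs : 0 < s) (hs1 : s ≤ 1)
    (hK : 0 < K) (hm : 0 ≤ m)
    (hθ : θ = 2 / (K * s)) (hW : 0 ≤ W) (hW' : 0 ≤ W') (hdrop : θ * W ≤ W - W') (k : ℕ)
    (hB : B = 2 * m * (3 * K) ^ k)
    (h1 : E1 ≤ 2 * B * W ^ p) (h2 : E2 ≤ 2 * m * W ^ p)
    (h3 : E3 ≤ 2 * m * (3 * K) ^ (k + 1) * W' ^ p) :
    E1 + E2 + E3 ≤ 2 * m * (3 * K) ^ (k + 1) * W ^ p := by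
  have hp0 : 0 < p := by rw [hp]; linarith
  have hB1 : 2 * m * (3 * K) ^ (k + 1) = 3 * K * B := by rw [hB]; ring
  rw [hB1] at h3 ⊢
  have hB0 : 0 ≤ B := by rw [hB]; positivity
  rcases hW.eq_or_lt with h0 | h0
  · have hz : W ^ p = 0 := by rw [← h0]; exact Real.zero_rpow hp0.ne'
    have h7 : W' = 0 := by rw [← h0] at hdrop; linarith
    rw [h7, Real.zero_rpow hp0.ne'] at h3
    rw [hz] at h1 h2 ⊢
    linarith
  · have hθ0 : 0 < θ := by rw [hθ]; positivity
    have hθ1 : θ ≤ 1 := by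
      by_contra hc
      push Not at hc
      nlinarith
    have hpt : p * θ = 1 / K := by rw [hp, hθ]; field_simp
    have hK1 : 1 ≤ 3 * K := by
      have : 1 / K ≤ 1 := by
        rw [← hpt]
        have : p ≤ 1 := by linarith
        nlinarith
      rw [div_le_one hK] at this
      linarith
    have hBm : 2 * m ≤ B := by
      rw [hB]
      have := one_le_pow₀ (n := k) hK1
      nlinarith
    have hWp : 0 ≤ W ^ p := Real.rpow_nonneg hW _
    have h4 : W' ^ p ≤ (1 - 1 / K) * W ^ p := by
      calc W' ^ p ≤ ((1 + -θ) * W) ^ p := Real.rpow_le_rpow hW' (by linarith) hp0.le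
        _ = (1 + -θ) ^ p * W ^ p := Real.mul_rpow (by linarith) hW
        _ ≤ (1 + p * -θ) * W ^ p := by
          apply mul_le_mul_of_nonneg_right _ hWp
          exact rpow_one_add_le_one_add_mul_self (by linarith) hp0.le (by linarith)
        _ = (1 - 1 / K) * W ^ p := by rw [← hpt]; ring
    have h5 : 3 * K * B * W' ^ p ≤ 3 * K * B * ((1 - 1 / K) * W ^ p) :=
      mul_le_mul_of_nonneg_left h4 (by positivity)
    have h6 : 3 * K * B * ((1 - 1 / K) * W ^ p) = 3 * K * B * W ^ p - 3 * B * W ^ p := by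
      field_simp
    nlinarith [mul_le_mul_of_nonneg_right hBm hWp]

variable (S : ExpSystem n d h)

lemma split_energy {s : ℝ} (hs : 0 < s) {k : ℕ} {B : ℝ} (hB : 0 ≤ B)
    (ihk : ∀ (N t0 : ℕ) (A : Finset (Fin n)),
      (∀ t, t0 ≤ t → t < t0 + N → Cl S t A ∧ (cmps S t A).card ≤ k) →
      ∑ t ∈ Finset.Ico t0 (t0 + N), en S s t A ≤ B * Wv S t0 A ^ (s / 2))
    (t0 N : ℕ) (A : Finset (Fin n)) (b : ℝ)
    (hA : ∀ t, t0 ≤ t → t < t0 + N → Cl S t A ∧ (cmps S t A).card ≤ k + 1)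
    (hL : (Lc S t0 A b).Nonempty) (hR : (Rc S t0 A b).Nonempty)
    (hc : ∀ t, t0 ≤ t → t < t0 + N → ¬ Crs S t0 A b t) :
    ∑ t ∈ Finset.Ico t0 (t0 + N), en S s t A ≤ 2 * B * Wv S t0 A ^ (s / 2) := by
  have hcard : ∀ t, t0 ≤ t → t < t0 + N →
      (cmps S t (Lc S t0 A b)).card ≤ k ∧ (cmps S t (Rc S t0 A b)).card ≤ k := by
    intro t h1 h2
    have h3 := card_split S t (cl_R S t0 b (hA t h1 h2).1 (hc t h1 h2)) (LR_disj S t0 A b)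
    rw [LR_union] at h3
    have h4 := (hA t h1 h2).2
    have h5 : 0 < (cmps S t (Lc S t0 A b)).card := Finset.card_pos.2 (hL.image _)
    have h6 : 0 < (cmps S t (Rc S t0 A b)).card := Finset.card_pos.2 (hR.image _)
    omega
  have h1 := ihk N t0 (Lc S t0 A b) fun t h1 h2 =>
    ⟨cl_L S t0 b (hA t h1 h2).1 (hc t h1 h2), (hcard t h1 h2).1⟩
  have h2 := ihk N t0 (Rc S t0 A b) fun t h1 h2 =>
    ⟨cl_R S t0 b (hA t h1 h2).1 (hc t h1 h2), (hcard t h1 h2).2⟩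
  have h3 : ∑ t ∈ Finset.Ico t0 (t0 + N), en S s t A =
      ∑ t ∈ Finset.Ico t0 (t0 + N), en S s t (Lc S t0 A b) +
      ∑ t ∈ Finset.Ico t0 (t0 + N), en S s t (Rc S t0 A b) := by
    rw [← Finset.sum_add_distrib]
    refine Finset.sum_congr rfl fun t ht => ?_
    rw [Finset.mem_Ico] at ht
    rw [← en_split S s t (cl_R S t0 b (hA t ht.1 ht.2).1 (hc t ht.1 ht.2)) (LR_disj S t0 A b),
      LR_union]
  have h4 : Wv S t0 (Lc S t0 A b) ^ (s / 2) ≤ Wv S t0 A ^ (s / 2) :=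
    Real.rpow_le_rpow (Wv_nonneg _ _ _) (Wv_mono S t0 (Finset.filter_subset _ _)) (by linarith)
  have h5 : Wv S t0 (Rc S t0 A b) ^ (s / 2) ≤ Wv S t0 A ^ (s / 2) :=
    Real.rpow_le_rpow (Wv_nonneg _ _ _) (Wv_mono S t0 (Finset.filter_subset _ _)) (by linarith)
  have h6 := mul_le_mul_of_nonneg_left h4 hB
  have h7 := mul_le_mul_of_nonneg_left h5 hB
  rw [h3]
  linarith

lemma main_ind (hn : 1 ≤ n) (hd : 1 ≤ d) (hh : 0 < h) {s : ℝ} (hs : 0 < s) (hs1 : s ≤ 1) (m : ℕ)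
    (hm : 1 ≤ m) (K : ℝ) (hK : K = 128 * (d : ℝ) ^ 3 * m * n / (h ^ 2 * s))
    (hK1 : 1 ≤ K) :
    ∀ k ≤ m, ∀ (N t0 : ℕ) (A : Finset (Fin n)),
      (∀ t, t0 ≤ t → t < t0 + N → Cl S t A ∧ (cmps S t A).card ≤ k) →
      ∑ t ∈ Finset.Ico t0 (t0 + N), en S s t A ≤ 2 * m * (3 * K) ^ k * Wv S t0 A ^ (s / 2) := by
  classical
  have hm' : (0 : ℝ) < m := by positivity
  have hn' : (0 : ℝ) < n := by positivity
  have hd' : (0 : ℝ) < d := by positivity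
  have hK0 : 0 < K := by rw [hK]; positivity
  have hrhs : ∀ k t A, 0 ≤ 2 * (m : ℝ) * (3 * K) ^ k * Wv S t A ^ (s / 2) := fun k t A =>
    mul_nonneg (by positivity) (Real.rpow_nonneg (Wv_nonneg _ _ _) _)
  have hempty : ∀ t, en S s t ∅ = 0 := fun t => by simp [en, cmps]
  intro k
  induction k with
  | zero =>
    intro _ N t0 A hA
    have h1 : ∑ t ∈ Finset.Ico t0 (t0 + N), en S s t A = 0 := by
      refine Finset.sum_eq_zero fun t ht => ?_
      rw [Finset.mem_Ico] at ht
      have := (hA t ht.1 ht.2).2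
      have h2 : cmps S t A = ∅ := Finset.card_eq_zero.1 (by omega)
      simp [en, h2]
    rw [h1]; exact hrhs _ _ _
  | succ k ihk =>
    intro hkm N
    have ihk' := ihk (by omega)
    induction N using Nat.strong_induction_on with
    | _ N ihN =>
    intro t0 A hA
    rcases A.eq_empty_or_nonempty with rfl | hne
    · simp only [hempty, Finset.sum_const_zero]; exact hrhs _ _ _
    rcases Nat.eq_zero_or_pos N with rfl | hN
    · simp only [add_zero, Finset.Ico_self, Finset.sum_empty]; exact hrhs _ _ _
    have hB0 : 0 ≤ 2 * (m : ℝ) * (3 * K) ^ k := by positivity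
    have hLne : ∀ C ∈ cmps S t0 A, (Lc S t0 A (hi S t0 C)).Nonempty := by
      intro C hC
      obtain ⟨v, hv, rfl⟩ := Finset.mem_image.1 hC
      exact ⟨v, Finset.mem_filter.2 ⟨hv, le_hi S t0 (self_mem_cmp S t0 v)⟩⟩
    set P : ℕ → Prop := fun j => ∀ C ∈ cmps S t0 A, (Rc S t0 A (hi S t0 C)).Nonempty →
      ∃ t, t0 ≤ t ∧ t < t0 + (j + 1) ∧ Crs S t0 A (hi S t0 C) t with hP
    have hsplit : ∀ j, j + 1 ≤ N → ¬ P j →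
        ∑ t ∈ Finset.Ico t0 (t0 + (j + 1)), en S s t A ≤
          2 * (2 * m * (3 * K) ^ k) * Wv S t0 A ^ (s / 2) := by
      intro j hj hPj
      simp only [hP] at hPj
      push Not at hPj
      obtain ⟨C, hC, hR, hcr⟩ := hPj
      exact split_energy S hs hB0 ihk' t0 (j + 1) A (hi S t0 C)
        (fun t h1 h2 => hA t h1 (by omega)) (hLne C hC) hR hcr
    by_cases hex : ∃ j, j < N ∧ P j
    · obtain ⟨hT1, hT2⟩ := Nat.find_spec hex
      have hmin : ∀ j, j < Nat.find hex → ¬ P j := fun j h1 h2 =>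
        Nat.find_min hex h1 ⟨by omega, h2⟩
      set T := Nat.find hex with hTd
      have hE1 : ∑ t ∈ Finset.Ico t0 (t0 + T), en S s t A ≤
          2 * (2 * m * (3 * K) ^ k) * Wv S t0 A ^ (s / 2) := by
        rcases Nat.eq_zero_or_pos T with h0 | h0
        · rw [h0]
          simp only [add_zero, Finset.Ico_self, Finset.sum_empty]
          have := hrhs k t0 A
          linarith
        · have := hsplit (T - 1) (by omega) (hmin _ (by omega))
          rwa [Nat.sub_add_cancel h0] at this
      have hE2 : en S s (t0 + T) A ≤ 2 * m * Wv S t0 A ^ (s / 2) := by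
        obtain ⟨h1, h2⟩ := hA (t0 + T) (by omega) (by omega)
        have h3 := en_le S hs hs1 (t0 + T) h1 (h2.trans hkm)
        have h4 : Wv S (t0 + T) A ^ (s / 2) ≤ Wv S t0 A ^ (s / 2) :=
          Real.rpow_le_rpow (Wv_nonneg _ _ _)
            (Wv_anti S hd hh t0 T fun t h5 h6 => (hA t h5 (by omega)).1) (by linarith)
        exact h3.trans (mul_le_mul_of_nonneg_left h4 (by positivity))
      have hE3 := ihN (N - (T + 1)) (by omega) (t0 + (T + 1)) A
        (fun t h1 h2 => hA t (by omega) (by omega))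
      rw [show t0 + (T + 1) + (N - (T + 1)) = t0 + N by omega] at hE3
      have hsum : ∑ t ∈ Finset.Ico t0 (t0 + N), en S s t A =
          ∑ t ∈ Finset.Ico t0 (t0 + T), en S s t A + en S s (t0 + T) A +
          ∑ t ∈ Finset.Ico (t0 + (T + 1)) (t0 + N), en S s t A := by
        rw [← Finset.sum_Ico_succ_top (by omega), ← add_assoc,
          Finset.sum_Ico_consecutive _ (by omega) (by omega)]
      have hA' : ∀ t, t0 ≤ t → t < t0 + (T + 1) → Cl S t A := fun t h1 h2 => (hA t h1 (by omega)).1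
      have hcov := phase_cover S hd t0 (t0 + (T + 1)) (by omega) hne hA'
        (hA t0 le_rfl (by omega)).2 hT2
      have hds := drop_sum S hd hh t0 (T + 1) hA'
      have hWle := Wv_le S t0 A
      have hdrop : 2 / (K * s) * Wv S t0 A ≤ Wv S t0 A - Wv S (t0 + (T + 1)) A := by
        set Sg := ∑ t ∈ Finset.Ico t0 (t0 + (T + 1)), ∑ C ∈ cmps S t A, sp S t C ^ 2 with hSg
        have hSg0 : 0 ≤ Sg :=
          Finset.sum_nonneg fun _ _ => Finset.sum_nonneg fun _ _ => sq_nonneg _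
        have e1 : Wv S t0 A ≤ n * (2 * m * Sg) := by
          refine hWle.trans (mul_le_mul_of_nonneg_left (hcov.trans ?_) hn'.le)
          apply mul_le_mul_of_nonneg_right _ hSg0
          have : ((k + 1 : ℕ) : ℝ) ≤ m := by exact_mod_cast hkm
          linarith
        have e2 : 2 / (K * s) * Wv S t0 A ≤ 2 / (K * s) * (n * (2 * m * Sg)) :=
          mul_le_mul_of_nonneg_left e1 (by positivity)
        have e3 : 2 / (K * s) * (n * (2 * m * Sg)) = h ^ 2 / (32 * (d : ℝ) ^ 3) * Sg := by
          rw [hK]; field_simp; ring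
        linarith
      rw [hsum]
      exact final_arith rfl hs hs1 hK0 hm'.le rfl (Wv_nonneg _ _ _) (Wv_nonneg _ _ _) hdrop k rfl
        hE1 hE2 hE3
    · push Not at hex
      have h1 := hsplit (N - 1) (by omega) (hex (N - 1) (by omega))
      rw [Nat.sub_add_cancel hN] at h1
      refine h1.trans (mul_le_mul_of_nonneg_right ?_ (Real.rpow_nonneg (Wv_nonneg _ _ _) _))
      rw [pow_succ]
      nlinarith

end EXS

namespace EXS

variable {n d : ℕ} {h : ℝ}

lemma rpow_sum_le' {ι : Type*} (F : Finset ι) (f : ι → ℝ) (hf : ∀ i, 0 ≤ f i) {s : ℝ} (hs : 0 < s)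
    (hs1 : s ≤ 1) : (∑ i ∈ F, f i) ^ s ≤ ∑ i ∈ F, f i ^ s := by
  classical
  induction F using Finset.induction_on with
  | empty => simp [Real.zero_rpow hs.ne']
  | insert a F ha ih =>
    rw [Finset.sum_insert ha, Finset.sum_insert ha]
    refine (Real.rpow_add_le_add_rpow (hf a) (Finset.sum_nonneg fun i _ => hf i) hs.le hs1).trans ?_
    linarith

variable (S : ExpSystem n d h)

lemma step_le {s : ℝ} (hs : 0 < s) (hs1 : s ≤ 1) (t : ℕ) :
    stepEnergy s (S.edgeUnion t) ≤ ENNReal.ofReal (en S s t Finset.univ) := by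
  classical
  set U := S.edgeUnion t with hU
  have hsub : ∀ i j, S.M t i j ≠ 0 → Set.uIcc (S.x t i) (S.x t j) ⊆ U := by
    intro i j hij z hz
    simp only [hU, ExpSystem.edgeUnion, Set.mem_iUnion]
    exact ⟨i, j, hij, hz⟩
  have hxU : ∀ i, S.x t i ∈ U := fun i =>
    hsub i i (by rw [S.M_diag]; norm_num) Set.left_mem_uIcc
  have hkap : ∀ i j, S.M t i j ≠ 0 → ∀ z ∈ Set.uIcc (S.x t i) (S.x t j),
      connectedComponentIn U (S.x t i) = connectedComponentIn U z := by
    intro i j hij z hz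
    apply connectedComponentIn_eq
    exact (isPreconnected_uIcc.subset_connectedComponentIn Set.left_mem_uIcc (hsub i j hij)) hz
  have hcmp : ∀ i j, j ∈ cmp S t i →
      connectedComponentIn U (S.x t i) = connectedComponentIn U (S.x t j) := by
    intro i j hj
    rw [mem_cmp] at hj
    induction hj with
    | refl => rfl
    | tail _ hbc ih => exact ih.trans (hkap _ _ hbc _ Set.right_mem_uIcc)
  set blk : Finset (Fin n) → Set ℝ := fun C => connectedComponentIn U (lo S t C) with hblk
  have hblk' : ∀ i, blk (cmp S t i) = connectedComponentIn U (S.x t i) := by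
    intro i
    obtain ⟨j, hj, hj'⟩ := exists_lo S t ⟨i, self_mem_cmp S t i⟩
    simp only [hblk]
    rw [← hj', hcmp i j hj]
  -- every point of U
  have hpt : ∀ a ∈ U, ∃ C ∈ cmps S t Finset.univ, blk C = connectedComponentIn U a ∧
      a ∈ Set.Icc (lo S t C) (hi S t C) := by
    intro a ha
    simp only [hU, ExpSystem.edgeUnion, Set.mem_iUnion] at ha
    obtain ⟨i, j, hij, haij⟩ := ha
    refine ⟨cmp S t i, Finset.mem_image_of_mem _ (Finset.mem_univ i), ?_, ?_⟩
    · rw [hblk', hkap i j hij a haij]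
    · have hi1 := self_mem_cmp S t i
      have hj1 : j ∈ cmp S t i := by rw [← cmp_edge S t hij]; exact self_mem_cmp S t j
      exact (Set.uIcc_subset_Icc ⟨lo_le S t hi1, le_hi S t hi1⟩ ⟨lo_le S t hj1, le_hi S t hj1⟩) haij
  have hdiam : ∀ B ∈ (cmps S t Finset.univ).image blk,
      Metric.diam B ≤ ∑ C ∈ cmps S t Finset.univ with blk C = B, sp S t C := by
    intro B hB
    obtain ⟨C0, hC0, rfl⟩ := Finset.mem_image.1 hB
    have hsum0 : 0 ≤ ∑ C ∈ cmps S t Finset.univ with blk C = blk C0, sp S t C :=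
      Finset.sum_nonneg fun C _ => sp_nonneg S t C
    have hpre : IsPreconnected (blk C0) := isPreconnected_connectedComponentIn
    have hcov : blk C0 ⊆ ⋃ C ∈ (cmps S t Finset.univ).filter (fun C => blk C = blk C0),
        Set.Icc (lo S t C) (hi S t C) := by
      intro a ha
      obtain ⟨C, hC, hC1, hC2⟩ := hpt a (connectedComponentIn_subset _ _ ha)
      simp only [Set.mem_iUnion]
      refine ⟨C, Finset.mem_filter.2 ⟨hC, ?_⟩, hC2⟩
      rw [hC1]
      exact (connectedComponentIn_eq ha).symm
    have key : ∀ p ∈ blk C0, ∀ q ∈ blk C0, p ≤ q →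
        q - p ≤ ∑ C ∈ cmps S t Finset.univ with blk C = blk C0, sp S t C := by
      intro p hp q hq hpq
      have h1 : Set.Icc p q ⊆ blk C0 := hpre.Icc_subset hp hq
      have h2 := (MeasureTheory.measure_mono (μ := MeasureTheory.volume) (h1.trans hcov)).trans
        (MeasureTheory.measure_biUnion_finset_le _ _)
      simp only [Real.volume_Icc] at h2
      change _ ≤ ∑ C ∈ (cmps S t Finset.univ).filter (fun C => blk C = blk C0),
        ENNReal.ofReal (sp S t C) at h2
      rw [← ENNReal.ofReal_sum_of_nonneg (fun C _ => sp_nonneg S t C)] at h2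
      exact (ENNReal.ofReal_le_ofReal_iff hsum0).1 h2
    apply Metric.diam_le_of_forall_dist_le hsum0
    intro p hp q hq
    rw [Real.dist_eq]
    rcases le_total p q with hpq | hpq
    · rw [abs_sub_comm, abs_of_nonneg (by linarith)]
      exact key p hp q hq hpq
    · rw [abs_of_nonneg (by linarith)]
      exact key q hq p hp hpq
  have hbs : blockSet U ⊆ (((cmps S t Finset.univ).image blk : Finset (Set ℝ)) : Set (Set ℝ)) := by
    rintro B ⟨a, ha, rfl⟩
    obtain ⟨C, hC, hC1, _⟩ := hpt a ha
    rw [Finset.mem_coe, ← hC1]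
    exact Finset.mem_image_of_mem _ hC
  unfold stepEnergy
  refine (ENNReal.tsum_mono_subtype (fun B : Set ℝ => ENNReal.ofReal (Metric.diam B ^ s)) hbs).trans ?_
  rw [Finset.tsum_subtype' ((cmps S t Finset.univ).image blk)
    (fun B : Set ℝ => ENNReal.ofReal (Metric.diam B ^ s)),
    ← ENNReal.ofReal_sum_of_nonneg (fun B _ => Real.rpow_nonneg Metric.diam_nonneg _)]
  apply ENNReal.ofReal_le_ofReal
  unfold en
  rw [← Finset.sum_fiberwise_of_maps_to (g := blk) (t := (cmps S t Finset.univ).image blk)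
    (fun C hC => Finset.mem_image_of_mem _ hC)]
  refine Finset.sum_le_sum fun B hB => ?_
  exact (Real.rpow_le_rpow Metric.diam_nonneg (hdiam B hB) hs.le).trans
    (rpow_sum_le' _ _ (fun C => sp_nonneg S t C) hs hs1)

lemma cl_univ (t : ℕ) : Cl S t Finset.univ := fun _ _ j _ => Finset.mem_univ j

lemma card_univ {m : ℕ} (hm : S.componentsLE m) (t : ℕ) : (cmps S t Finset.univ).card ≤ m := by
  classical
  obtain ⟨c, _, hc⟩ := hm t
  have : (cmps S t Finset.univ).card ≤ (Finset.univ.image c).card := by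
    have hinv : ∀ C ∈ cmps S t Finset.univ, ∃ i, cmp S t i = C := by
      intro C hC
      obtain ⟨v, _, hv⟩ := Finset.mem_image.1 hC
      exact ⟨v, hv⟩
    rcases isEmpty_or_nonempty (Fin n) with he | he
    · have h0 : cmps S t Finset.univ = ∅ := by
        apply Finset.eq_empty_of_forall_notMem
        intro C hC
        obtain ⟨i, _⟩ := hinv C hC
        exact he.elim i
      rw [h0]; simp
    choose! r hr using hinv
    apply Finset.card_le_card_of_injOn (fun C => c (r C))
    · intro C _
      simp
    · intro C hC C' hC' hcc
      rw [← hr C hC, ← hr C' hC']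
      exact (cmp_eq S t ((mem_cmp S t).2 (hc _ _ hcc))).symm
  exact this.trans ((Finset.card_le_univ _).trans (by simp))

lemma h_le {m : ℕ} (hm : S.componentsLE m) (hmn : m < n) : h ≤ d := by
  classical
  obtain ⟨c, _, hc⟩ := hm 0
  obtain ⟨i, j, hij, hcij⟩ := Fintype.exists_ne_map_eq_of_card_lt c (by simpa using hmn)
  have hj : j ∈ cmp S 0 i := (mem_cmp S 0).2 (hc i j hcij)
  have hi := self_mem_cmp S 0 i
  have h2 : 2 ≤ (cmp S 0 i).card := by
    have := Finset.card_le_card (s := {i, j}) (t := cmp S 0 i) (by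
      intro k hk; simp at hk; rcases hk with rfl | rfl <;> assumption)
    rwa [Finset.card_pair hij] at this
  have h3 := cmp_cheeger S 0 i {i} (by simpa using hi) (by simpa using h2)
  simp only [Finset.card_singleton, Nat.cast_one, mul_one] at h3
  refine h3.trans ?_
  rw [Finset.sum_eq_single i]
  · rw [← S.M_deg 0 i]
    refine le_trans (Finset.sum_le_sum fun k _ => ?_)
      (Finset.sum_le_sum_of_subset_of_nonneg (Finset.subset_univ (cmp S 0 i))
        (fun k _ _ => M_nonneg S 0 i k))
    have := M_nonneg S 0 i k
    split_ifs <;> linarith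
  · intro k _ hk
    apply Finset.sum_eq_zero
    intro l _
    simp [hk]
  · intro hc; exact absurd hi hc

end EXS

/-- There is an absolute constant `a > 0` such that for every expanding
averaging system with degree `d`, Cheeger constant `h`, at most `m` connected components
at each time, and every `s ∈ (0,1]`, the maximum `s`-energy satisfies
`𝓔^exp_{m,s} ≤ (a·d³·m·n/(h²·s))^m`. -/
theorem expSEnergy_le :
    ∃ a : ℝ, 0 < a ∧
      ∀ (n d m : ℕ) (h s : ℝ), 2 ≤ n → 1 ≤ d → 0 < h → 0 < s → s ≤ 1 →
        1 ≤ m → m ≤ n - 1 →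
        ∀ S : ExpSystem n d h,
          S.componentsLE m →
          S.initVarLEOne →
          S.energy s ≤ ENNReal.ofReal ((a * d ^ 3 * m * n / (h ^ 2 * s)) ^ m) := by
  refine ⟨1536, by norm_num, ?_⟩
  intro n d m h s hn hd hh hs hs1 hm hmn S hS hV
  have hd1 : (1 : ℝ) ≤ d := by exact_mod_cast hd
  have hm1 : (1 : ℝ) ≤ m := by exact_mod_cast hm
  have hn1 : (1 : ℝ) ≤ n := by exact_mod_cast (by omega : 1 ≤ n)
  obtain ⟨K, hK⟩ : ∃ K : ℝ, K = 128 * (d : ℝ) ^ 3 * m * n / (h ^ 2 * s) := ⟨_, rfl⟩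
  have hhd := EXS.h_le S hS (by omega)
  have hK1 : 1 ≤ K := by
    rw [hK, le_div_iff₀ (by positivity), one_mul]
    have e1 : h ^ 2 * s ≤ h ^ 2 := by nlinarith [sq_nonneg h]
    have e2 : h ^ 2 ≤ (d : ℝ) ^ 2 := pow_le_pow_left₀ hh.le hhd 2
    have e3 : (d : ℝ) ^ 2 ≤ (d : ℝ) ^ 3 := pow_le_pow_right₀ hd1 (by norm_num)
    have e4 : (d : ℝ) ^ 3 * 1 * 1 ≤ (128 * (d : ℝ) ^ 3) * m * n := by
      gcongr
      nlinarith [pow_pos (lt_of_lt_of_le one_pos hd1) 3]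
    linarith
  have hW : EXS.Wv S 0 Finset.univ ≤ 1 := by
    have h1 : (d : ℝ) * EXS.Wv S 0 Finset.univ ≤ 1 := by
      have := hV
      unfold ExpSystem.initVarLEOne at this
      simpa [EXS.Wv] using this
    nlinarith [EXS.Wv_nonneg S 0 Finset.univ]
  have hWp : EXS.Wv S 0 Finset.univ ^ (s / 2) ≤ 1 :=
    Real.rpow_le_one (EXS.Wv_nonneg _ _ _) hW (by linarith)
  have hfin : 2 * (m : ℝ) * (3 * K) ^ m ≤ (1536 * d ^ 3 * m * n / (h ^ 2 * s)) ^ m := by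
    have e : 1536 * (d : ℝ) ^ 3 * m * n / (h ^ 2 * s) = 4 * (3 * K) := by rw [hK]; ring
    rw [e, mul_pow 4 (3 * K) m]
    apply mul_le_mul_of_nonneg_right _ (by positivity)
    have h1 : (m : ℝ) ≤ 2 ^ m := by exact_mod_cast (Nat.lt_two_pow_self (n := m)).le
    have h2 : (2 : ℝ) ≤ 2 ^ m := by
      calc (2 : ℝ) = 2 ^ 1 := by norm_num
        _ ≤ 2 ^ m := pow_le_pow_right₀ (by norm_num) hm
    calc 2 * (m : ℝ) ≤ 2 ^ m * 2 ^ m := mul_le_mul h2 h1 (by positivity) (by positivity)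
      _ = 4 ^ m := by rw [← mul_pow]; norm_num
  unfold ExpSystem.energy
  apply ENNReal.tsum_le_of_sum_range_le
  intro N
  have hmain := EXS.main_ind S (by omega) hd hh hs hs1 m hm K hK hK1 m le_rfl N 0 Finset.univ
    (fun t _ _ => ⟨EXS.cl_univ S t, EXS.card_univ S hS t⟩)
  rw [zero_add, ← Finset.range_eq_Ico] at hmain
  calc ∑ t ∈ Finset.range N, stepEnergy s (S.edgeUnion t)
      ≤ ∑ t ∈ Finset.range N, ENNReal.ofReal (EXS.en S s t Finset.univ) :=
        Finset.sum_le_sum fun t _ => EXS.step_le S hs hs1 t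
    _ = ENNReal.ofReal (∑ t ∈ Finset.range N, EXS.en S s t Finset.univ) :=
        (ENNReal.ofReal_sum_of_nonneg fun t _ =>
          Finset.sum_nonneg fun C _ => Real.rpow_nonneg (EXS.sp_nonneg S t C) _).symm
    _ ≤ _ := by
        apply ENNReal.ofReal_le_ofReal
        refine hmain.trans (le_trans ?_ hfin)
        exact mul_le_of_le_one_right (by positivity) hWp
end

section
/- For every fixed d > 3 there is a constant c > 0 (depending only on d) such that for every n, every s ∈ (0,1], and every initial condition of scaled variance at most 1, the expected s-energy of a random averaging system satisfies 𝔼 𝓔^ran_s ≤ c/s. -/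
open scoped BigOperators ENNReal
open MeasureTheory

/-- The set of adjacency matrices of simple `(d-1)`-regular graphs on `n` vertices. -/
def RegAdj (n d : ℕ) : Set (Matrix (Fin n) (Fin n) ℝ) :=
  {A | (∀ i j, A i j = 0 ∨ A i j = 1) ∧ (∀ i j, A i j = A j i) ∧
       (∀ i, A i i = 0) ∧ (∀ i, ∑ j, A i j = (d : ℝ) - 1)}

lemma regAdj_finite (n d : ℕ) : (RegAdj n d).Finite := by
  have h : (Set.pi Set.univ (fun _ : Fin n => Set.pi Set.univ (fun _ : Fin n => ({0, 1} : Set ℝ)))).Finite :=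
    Set.Finite.pi' (fun _ => Set.Finite.pi' (fun _ => Set.toFinite _)) |>.subset (by
      intro f hf i j
      exact hf i trivial j trivial)
  refine h.subset ?_
  intro A hA i _ j _
  have := hA.1 i j
  simpa using this

noncomputable def RF (n d : ℕ) : Finset (Matrix (Fin n) (Fin n) ℝ) := (regAdj_finite n d).toFinset

lemma mem_RF {n d : ℕ} {A : Matrix (Fin n) (Fin n) ℝ} : A ∈ RF n d ↔ A ∈ RegAdj n d := by
  simp [RF]

lemma submatrix_mem {n d : ℕ} {A : Matrix (Fin n) (Fin n) ℝ} (hA : A ∈ RF n d)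
    (σ : Equiv.Perm (Fin n)) : A.submatrix σ σ ∈ RF n d := by
  rw [mem_RF] at *
  obtain ⟨h1, h2, h3, h4⟩ := hA
  refine ⟨fun i j => h1 _ _, fun i j => h2 _ _, fun i => h3 _, fun i => ?_⟩
  rw [← h4 (σ i)]
  exact Equiv.sum_comp σ (fun j => A (σ i) j)

lemma sum_RF_submatrix {n d : ℕ} (σ : Equiv.Perm (Fin n)) {β : Type*} [AddCommMonoid β]
    (f : Matrix (Fin n) (Fin n) ℝ → β) :
    ∑ A ∈ RF n d, f (A.submatrix σ σ) = ∑ A ∈ RF n d, f A := by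
  refine Finset.sum_nbij' (fun A => A.submatrix σ σ) (fun A => A.submatrix σ.symm σ.symm)
    (fun A hA => submatrix_mem hA σ) (fun A hA => submatrix_mem hA σ.symm) ?_ ?_ ?_
  · intro A _; ext i j; simp
  · intro A _; ext i j; simp
  · intro A _; rfl

def Cl {n : ℕ} (A : Matrix (Fin n) (Fin n) ℝ) (S : Finset (Fin n)) : Prop :=
  ∀ i ∈ S, ∀ j, A i j ≠ 0 → j ∈ S

open Classical in
noncomputable def cnt (n d : ℕ) (S : Finset (Fin n)) : ℕ := ((RF n d).filter (fun A => Cl A S)).card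

lemma cnt_eq {n d : ℕ} {S T : Finset (Fin n)} (h : S.card = T.card) : cnt n d S = cnt n d T := by
  classical
  let e : {x // x ∈ S} ≃ {x // x ∈ T} := Finset.equivOfCardEq h
  let σ : Equiv.Perm (Fin n) := e.extendSubtype
  have hσ : ∀ x, σ x ∈ T ↔ x ∈ S := by
    intro x
    constructor
    · intro hx
      by_contra hn
      exact e.extendSubtype_not_mem x hn hx
    · intro hx
      exact e.extendSubtype_mem x hx
  unfold cnt
  rw [Finset.card_filter, Finset.card_filter,
    ← sum_RF_submatrix σ (fun A => if Cl A S then 1 else 0)]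
  refine Finset.sum_congr rfl fun A _ => ?_
  have : Cl (A.submatrix σ σ) S ↔ Cl A T := by
    simp only [Cl, Matrix.submatrix_apply]
    constructor
    · intro h i hi j hij
      have := h (σ.symm i) ((hσ _).1 (by simpa using hi)) (σ.symm j) (by simpa using hij)
      simpa using (hσ _).2 this
    · intro h i hi j hij
      exact (hσ _).1 (h (σ i) ((hσ _).2 hi) (σ j) hij)
  simp only [this]

lemma cl_count {n d : ℕ} (hd : 3 < d) {A : Matrix (Fin n) (Fin n) ℝ} (hA : A ∈ RF n d) (k : ℕ) 
    (P : Finset (Fin n) → Prop) [DecidablePred P] (hP : ∀ S, P S → Cl A S) :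
    ((Finset.powersetCard k (Finset.univ : Finset (Fin n))).filter P).card ≤ n.choose (k / 2) := by
  classical
  rw [mem_RF] at hA
  obtain ⟨h1, h2, h3, h4⟩ := hA
  let H : SimpleGraph (Fin n) :=
    { Adj := fun i j => A i j ≠ 0
      symm := ⟨fun i j h => by rw [h2 j i]; exact h⟩
      loopless := ⟨fun i h => h (h3 i)⟩ }
  let c : Fin n → H.ConnectedComponent := H.connectedComponentMk
  have hcl : ∀ S, Cl A S → ∀ u v, u ∈ S → c u = c v → v ∈ S := by
    intro S hS u v hu huv
    have hr : H.Reachable u v := SimpleGraph.ConnectedComponent.exact huv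
    obtain ⟨w⟩ := hr
    clear huv
    induction w with
    | nil => exact hu
    | cons h p ih => exact ih (hS _ hu _ h)
  have hnb : ∀ u, ∃ v, v ≠ u ∧ A u v ≠ 0 := by
    intro u
    by_contra! hcon
    have : ∑ j, A u j = 0 := Finset.sum_eq_zero fun j _ => by
      by_cases hj : j = u
      · rw [hj]; exact h3 u
      · exact hcon j hj
    rw [h4] at this
    have : (3:ℝ) < d := by exact_mod_cast hd
    linarith
  have hex : ∀ S ∈ (Finset.powersetCard k (Finset.univ : Finset (Fin n))).filter P, 
      ∃ T ∈ Finset.powersetCard (k/2) (Finset.univ : Finset (Fin n)), 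
        S = Finset.univ.filter (fun v => ∃ t ∈ T, c t = c v) := by
    intro S hS
    obtain ⟨hk, hPS⟩ := Finset.mem_filter.1 hS
    have hk := (Finset.mem_powersetCard.1 hk).2
    have hSc := hP S hPS
    have hout : ∀ q : H.ConnectedComponent, c q.out = q := fun q => Quot.out_eq q
    have him : 2 * (S.image c).card ≤ S.card := by
      apply Finset.mul_card_image_le_card
      intro q hq
      obtain ⟨u, hu, rfl⟩ := Finset.mem_image.1 hq
      obtain ⟨v, hv, huv⟩ := hnb u
      have hcv : c v = c u := (SimpleGraph.ConnectedComponent.sound (SimpleGraph.Adj.reachable (G := H) huv)).symm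
      rw [Nat.succ_le_iff, Finset.one_lt_card]
      exact ⟨u, by simp [hu], v, by simp [hSc u hu v huv, hcv], hv.symm⟩
    let T0 := (S.image c).image (fun q => q.out)
    have hT0S : T0 ⊆ S := by
      intro t ht
      obtain ⟨q, hq, rfl⟩ := Finset.mem_image.1 ht
      obtain ⟨u, hu, rfl⟩ := Finset.mem_image.1 hq
      exact hcl S hSc u _ hu (hout _).symm
    have hT0c : T0.card ≤ k / 2 := by
      have : T0.card ≤ (S.image c).card := Finset.card_image_le
      omega
    obtain ⟨T, hT0T, hTS, hTc⟩ := Finset.exists_subsuperset_card_eq hT0S hT0c (by omega)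
    refine ⟨T, by simp [hTc], ?_⟩
    ext v
    simp only [Finset.mem_filter, Finset.mem_univ, true_and]
    constructor
    · intro hv
      exact ⟨(c v).out, hT0T (Finset.mem_image_of_mem _ (Finset.mem_image_of_mem _ hv)), hout _⟩
    · rintro ⟨t, ht, htv⟩
      exact hcl S hSc t v (hTS ht) htv
  choose! F hF1 hF2 using hex
  have := Finset.card_le_card_of_injOn F hF1 (by
    intro S hS T hT hST
    rw [hF2 S hS, hF2 T hT, hST])
  simpa using this

lemma choose_ratio (a b : ℕ) (h : 3 * b ≤ 2 * a) (m : ℕ) : 3 ^ m * b.choose m ≤ 2 ^ m * a.choose m := by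
  have : ∀ m, 3 ^ m * b.descFactorial m ≤ 2 ^ m * a.descFactorial m := by
    intro m
    induction m with
    | zero => simp
    | succ m ih =>
      rw [Nat.descFactorial_succ, Nat.descFactorial_succ]
      have h2 : 3 * (b - m) ≤ 2 * (a - m) := by omega
      calc 3 ^ (m+1) * ((b - m) * b.descFactorial m) = (3 * (b-m)) * (3 ^ m * b.descFactorial m) := by ring
        _ ≤ (2 * (a-m)) * (2 ^ m * a.descFactorial m) := Nat.mul_le_mul h2 ih
        _ = _ := by ring
  have h3 := this m
  rw [Nat.descFactorial_eq_factorial_mul_choose, Nat.descFactorial_eq_factorial_mul_choose] at h3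
  have h4 := Nat.factorial_pos m
  refine Nat.le_of_mul_le_mul_left ?_ h4
  linarith

lemma cnt_small {n d : ℕ} (hd : 3 < d) (S : Finset (Fin n)) (hS : 2 * S.card ≤ n) :
    (cnt n d S : ℝ) ≤ (RF n d).card * (5 / 6 : ℝ) ^ S.card := by
  classical
  set k := S.card with hk
  obtain ⟨j, hj⟩ : ∃ j, j = k / 2 := ⟨_, rfl⟩
  obtain ⟨m, hm⟩ : ∃ m, m = k - j := ⟨_, rfl⟩
  have h1 : n.choose k * cnt n d S ≤ (RF n d).card * n.choose j := by
    calc n.choose k * cnt n d S = ∑ T ∈ Finset.powersetCard k (Finset.univ : Finset (Fin n)), cnt n d T := by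
          rw [Finset.sum_congr rfl (g := fun _ => cnt n d S)]
          · simp
          · intro T hT
            exact cnt_eq (by rw [(Finset.mem_powersetCard.1 hT).2])
      _ = ∑ A ∈ RF n d, ((Finset.powersetCard k (Finset.univ : Finset (Fin n))).filter (fun T => Cl A T)).card := by
          simp only [cnt, Finset.card_filter]
          rw [Finset.sum_comm]
      _ ≤ ∑ A ∈ RF n d, n.choose j := Finset.sum_le_sum fun A hA => by
          rw [hj]; exact cl_count hd hA k _ (fun _ h => h)
      _ = _ := by simp
  have h2 : 3 ^ m * n.choose j ≤ 2 ^ m * n.choose k := by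
    have h3 := choose_ratio (n - j) k (by omega) m
    have h4 : n.choose k * k.choose j = n.choose j * (n - j).choose (k - j) := 
      Nat.choose_mul (by omega)
    rw [← hm] at h4
    have h5 : k.choose m = k.choose j := by rw [hm]; exact Nat.choose_symm (by omega)
    rw [h5] at h3
    refine Nat.le_of_mul_le_mul_right ?_ (Nat.choose_pos (show j ≤ k by omega))
    calc 3 ^ m * n.choose j * k.choose j = n.choose j * (3 ^ m * k.choose j) := by ring
      _ ≤ n.choose j * (2 ^ m * (n-j).choose m) := Nat.mul_le_mul_left _ h3
      _ = 2 ^ m * (n.choose k * k.choose j) := by rw [h4]; ring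
      _ = _ := by ring
  have h6 : 3 ^ m * cnt n d S ≤ 2 ^ m * (RF n d).card := by
    refine Nat.le_of_mul_le_mul_left ?_ (Nat.choose_pos (show k ≤ n by omega))
    calc n.choose k * (3 ^ m * cnt n d S) = 3 ^ m * (n.choose k * cnt n d S) := by ring
      _ ≤ 3 ^ m * ((RF n d).card * n.choose j) := Nat.mul_le_mul_left _ h1
      _ = (RF n d).card * (3 ^ m * n.choose j) := by ring
      _ ≤ (RF n d).card * (2 ^ m * n.choose k) := Nat.mul_le_mul_left _ h2
      _ = _ := by ring
  have h7 : (3:ℝ) ^ m * cnt n d S ≤ 2 ^ m * (RF n d).card := by exact_mod_cast h6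
  have h8 : ((2:ℝ)/3) ^ m ≤ (5/6) ^ k := by
    calc ((2:ℝ)/3) ^ m ≤ ((5/6)^2) ^ m := pow_le_pow_left₀ (by norm_num) (by norm_num) _
      _ = (5/6) ^ (2 * m) := by rw [pow_mul]
      _ ≤ (5/6) ^ k := pow_le_pow_of_le_one (by norm_num) (by norm_num) (by omega)
  calc (cnt n d S : ℝ) ≤ (RF n d).card * (2/3 : ℝ) ^ m := by
        rw [div_pow, mul_div_assoc', le_div_iff₀ (by positivity)]
        linarith
    _ ≤ _ := by gcongr

lemma cnt_compl {n d : ℕ} (S : Finset (Fin n)) : cnt n d Sᶜ = cnt n d S := by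
  classical
  unfold cnt
  congr 1
  apply Finset.filter_congr
  intro A hA
  have h2 := (mem_RF.1 hA).2.1
  simp only [Cl, Finset.mem_compl]
  constructor
  · intro h i hi j hij
    by_contra hj
    exact h j hj i (by rwa [h2 j i]) hi
  · intro h i hi j hij hj
    exact hi (h j hj i (by rwa [h2 j i]))

lemma cnt_le {n d : ℕ} (hd : 3 < d) (S : Finset (Fin n)) :
    (cnt n d S : ℝ) ≤ (RF n d).card * ((5 / 6 : ℝ) ^ S.card + (5 / 6 : ℝ) ^ (n - S.card)) := by
  rw [mul_add]
  have p1 : 0 ≤ ((RF n d).card : ℝ) * (5/6:ℝ) ^ S.card := by positivity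
  have p2 : 0 ≤ ((RF n d).card : ℝ) * (5/6:ℝ) ^ (n - S.card) := by positivity
  by_cases h : 2 * S.card ≤ n
  · linarith [cnt_small hd S h]
  · have hc : Sᶜ.card = n - S.card := by rw [Finset.card_compl, Fintype.card_fin]
    have := cnt_small hd Sᶜ (by omega)
    rw [cnt_compl, hc] at this
    linarith

noncomputable def mean {n : ℕ} (v : Fin n → ℝ) : ℝ := (∑ j, v j) / n
noncomputable def VV {n : ℕ} (v : Fin n → ℝ) : ℝ := ∑ i, (v i - mean v) ^ 2
noncomputable def stp {n : ℕ} (d : ℕ) (v : Fin n → ℝ) (A : Matrix (Fin n) (Fin n) ℝ) : Fin n → ℝ :=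
  fun i => (1 / (d : ℝ)) * (v i + ∑ j, A i j * v j)

lemma VV_nonneg {n : ℕ} (v : Fin n → ℝ) : 0 ≤ VV v := Finset.sum_nonneg fun _ _ => sq_nonneg _

lemma mean_stp {n d : ℕ} (hd : 3 < d) (v : Fin n → ℝ) {A : Matrix (Fin n) (Fin n) ℝ}
    (hA : A ∈ RF n d) : mean (stp d v A) = mean v := by
  obtain ⟨h1, h2, h3, h4⟩ := mem_RF.1 hA
  unfold mean stp
  congr 1
  rw [← Finset.mul_sum, Finset.sum_add_distrib, Finset.sum_comm]
  have : ∀ j, ∑ i, A i j * v j = ((d:ℝ) - 1) * v j := by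
    intro j
    rw [← Finset.sum_mul, ← h4 j]
    congr 1
    exact Finset.sum_congr rfl fun i _ => h2 i j
  simp only [this]
  rw [← Finset.mul_sum]
  have : (3:ℝ) < d := by exact_mod_cast hd
  field_simp
  ring

lemma exists_perm2 {n : ℕ} {i j i' j' : Fin n} (h : i ≠ j) (h' : i' ≠ j') :
    ∃ σ : Equiv.Perm (Fin n), σ i = i' ∧ σ j = j' := by
  refine ⟨Equiv.swap (Equiv.swap i i' j) j' * Equiv.swap i i', ?_, ?_⟩
  · simp only [Equiv.Perm.mul_apply, Equiv.swap_apply_left]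
    apply Equiv.swap_apply_of_ne_of_ne _ h'
    intro hc
    have : Equiv.swap i i' i = Equiv.swap i i' j := by rw [Equiv.swap_apply_left]; exact hc
    exact h ((Equiv.swap i i').injective this)
  · simp

/-- The accumulated kernel. -/
noncomputable def KK (n d : ℕ) (j k : Fin n) : ℝ :=
  ∑ A ∈ RF n d, ∑ i, ((if i = j then 1 else 0) + A i j) * ((if i = k then 1 else 0) + A i k)

lemma KK_perm {n d : ℕ} (σ : Equiv.Perm (Fin n)) (j k : Fin n) : KK n d (σ j) (σ k) = KK n d j k := by
  unfold KK
  rw [← sum_RF_submatrix σ (fun A => ∑ i, ((if i = j then 1 else 0) + A i j) * ((if i = k then 1 else 0) + A i k))]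
  refine Finset.sum_congr rfl fun A _ => ?_
  rw [← Equiv.sum_comp σ]
  simp [Matrix.submatrix_apply]

lemma KK_nonneg {n d : ℕ} (j k : Fin n) : 0 ≤ KK n d j k := by
  refine Finset.sum_nonneg fun A hA => Finset.sum_nonneg fun i _ => ?_
  have h : ∀ i j, 0 ≤ A i j := fun i j => by
    rcases (mem_RF.1 hA).1 i j with h | h <;> rw [h] <;> norm_num
  have := h i j
  have := h i k
  apply mul_nonneg <;> split_ifs <;> linarith

lemma KK_diag {n d : ℕ} (j : Fin n) : KK n d j j = (RF n d).card * d := by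
  unfold KK
  rw [Finset.sum_congr rfl (g := fun _ => (d:ℝ))]
  · simp
  · intro A hA
    obtain ⟨h1, h2, h3, h4⟩ := mem_RF.1 hA
    have : ∀ i, ((if i = j then (1:ℝ) else 0) + A i j) * ((if i = j then 1 else 0) + A i j)
        = (if i = j then 1 else 0) + A j i := by
      intro i
      rw [h2 j i]
      split_ifs with h
      · rw [h, h3]; norm_num
      · rcases h1 i j with h | h <;> rw [h] <;> norm_num
    simp only [this]
    rw [Finset.sum_add_distrib, h4]
    simp

lemma KK_quad {n d : ℕ} (w : Fin n → ℝ) (hw : ∑ i, w i = 0) :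
    ∑ j, ∑ k, KK n d j k * (w j * w k) ≤ (RF n d).card * d * ∑ i, w i ^ 2 := by
  have hκ : ∃ κ : ℝ, 0 ≤ κ ∧ ∀ j k, j ≠ k → KK n d j k = κ := by
    by_cases h : ∃ a b : Fin n, a ≠ b
    · obtain ⟨a, b, hab⟩ := h
      refine ⟨KK n d a b, KK_nonneg _ _, fun j k hjk => ?_⟩
      obtain ⟨σ, h1, h2⟩ := exists_perm2 hab hjk
      rw [← h1, ← h2, KK_perm]
    · push Not at h
      exact ⟨0, le_rfl, fun j k hjk => absurd (h j k) hjk⟩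
  obtain ⟨κ, hκ0, hκ⟩ := hκ
  have hK : ∀ j k, KK n d j k = κ + (if j = k then (RF n d).card * d - κ else 0) := by
    intro j k
    split_ifs with h
    · rw [h, KK_diag]; ring
    · rw [hκ j k h]; ring
  have : ∑ j, ∑ k, KK n d j k * (w j * w k) = κ * ((∑ i, w i) * ∑ i, w i) + ((RF n d).card * d - κ) * ∑ i, w i ^ 2 := by
    simp only [hK, add_mul, Finset.sum_add_distrib, ite_mul, zero_mul, Finset.sum_ite_eq, Finset.mem_univ, if_true]
    rw [Finset.sum_mul_sum]
    simp only [Finset.mul_sum, pow_two]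
  rw [this, hw]
  have : 0 ≤ κ * ∑ i, w i ^ 2 := mul_nonneg hκ0 (Finset.sum_nonneg fun _ _ => sq_nonneg _)
  linarith

lemma VV_contract {n d : ℕ} (hd : 3 < d) (v : Fin n → ℝ) :
    ∑ A ∈ RF n d, VV (stp d v A) ≤ (RF n d).card * (VV v / d) := by
  have hd0 : (0:ℝ) < d := by
    have : (3:ℝ) < d := by exact_mod_cast hd
    linarith
  set w : Fin n → ℝ := fun i => v i - mean v with hwdef
  have hw : ∑ i, w i = 0 := by
    simp only [hwdef, Finset.sum_sub_distrib, mean]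
    rcases Nat.eq_zero_or_pos n with h | h
    · subst h; simp
    · simp only [Finset.sum_const, Finset.card_univ, Fintype.card_fin, nsmul_eq_mul]
      field_simp
      simp
  have h1 : ∀ A ∈ RF n d, VV (stp d v A) = (1/(d:ℝ)^2) * 
      ∑ j, ∑ k, (∑ i, ((if i = j then 1 else 0) + A i j) * ((if i = k then 1 else 0) + A i k)) * (w j * w k) := by
    intro A hA
    have e1 : ∀ i, stp d v A i - mean (stp d v A) = (1/(d:ℝ)) * ∑ j, ((if i = j then 1 else 0) + A i j) * w j := by
      intro i
      rw [mean_stp hd v hA]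
      obtain ⟨_, h2, h3, h4⟩ := mem_RF.1 hA
      simp only [stp, add_mul, Finset.sum_add_distrib, ite_mul, one_mul, zero_mul, Finset.sum_ite_eq, Finset.mem_univ, if_true]
      simp only [hwdef, mul_sub, Finset.sum_sub_distrib]
      rw [← Finset.sum_mul, h4]
      field_simp
      ring
    unfold VV
    simp only [e1, mul_pow]
    rw [← Finset.mul_sum]
    congr 1
    · ring
    · simp only [pow_two, Finset.sum_mul_sum]
      rw [Finset.sum_comm]
      refine Finset.sum_congr rfl fun j _ => ?_
      rw [Finset.sum_comm]
      refine Finset.sum_congr rfl fun k _ => ?_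
      rw [Finset.sum_mul]
      refine Finset.sum_congr rfl fun i _ => ?_
      ring
  rw [Finset.sum_congr rfl h1, ← Finset.mul_sum]
  have h2 : ∑ A ∈ RF n d, ∑ j, ∑ k, (∑ i, ((if i = j then 1 else 0) + A i j) * ((if i = k then 1 else 0) + A i k)) * (w j * w k) = ∑ j, ∑ k, KK n d j k * (w j * w k) := by
    rw [Finset.sum_comm]
    refine Finset.sum_congr rfl fun j _ => ?_
    rw [Finset.sum_comm]
    refine Finset.sum_congr rfl fun k _ => ?_
    rw [KK, Finset.sum_mul]
  rw [h2]
  have h3 := KK_quad (d := d) w hw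
  calc _ ≤ (1/(d:ℝ)^2) * ((RF n d).card * d * ∑ i, w i ^ 2) := by gcongr
    _ = _ := by
      simp only [VV, hwdef]
      field_simp

lemma VV_jensen {n d : ℕ} (hd : 3 < d) (hne : (RF n d).Nonempty) (v : Fin n → ℝ) {p : ℝ} (hp : 0 ≤ p) (hp1 : p ≤ 1) :
    ((RF n d).card : ℝ)⁻¹ * ∑ A ∈ RF n d, (VV (stp d v A)) ^ p ≤ (VV v) ^ p * ((d:ℝ)⁻¹) ^ p := by
  have hN : (0:ℝ) < (RF n d).card := by exact_mod_cast hne.card_pos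
  have := (Real.concaveOn_rpow hp hp1).le_map_sum (t := RF n d) (w := fun _ => ((RF n d).card : ℝ)⁻¹)
    (p := fun A => VV (stp d v A)) (fun _ _ => by positivity) (by simp [hN.ne']) (fun A _ => VV_nonneg _)
  simp only [smul_eq_mul, ← Finset.mul_sum] at this
  refine this.trans ?_
  rw [← Real.mul_rpow (VV_nonneg _) (by positivity)]
  apply Real.rpow_le_rpow (mul_nonneg (by positivity) (Finset.sum_nonneg fun _ _ => VV_nonneg _)) _ hp
  rw [inv_mul_le_iff₀ hN]
  exact VV_contract hd v

def UU {n : ℕ} (A : Matrix (Fin n) (Fin n) ℝ) (v : Fin n → ℝ) : Set ℝ :=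
  ⋃ (i : Fin n) (j : Fin n) (_ : A i j ≠ 0 ∨ i = j), Set.uIcc (v i) (v j)

noncomputable def SS {n : ℕ} (v : Fin n → ℝ) (k : ℕ) : Finset (Fin n) :=
  Finset.univ.filter (fun i => ((Tuple.sort v).symm i).val < k)

lemma SS_card {n : ℕ} (v : Fin n → ℝ) (k : ℕ) (hk : k ≤ n) : (SS v k).card = k := by
  have : SS v k = (Finset.univ.filter (fun i : Fin n => i.val < k)).map (Tuple.sort v).toEmbedding := by
    ext i
    simp [SS]
  rw [this, Finset.card_map, Fin.card_filter_val_lt]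
  omega

lemma card_image_range {α : Type*} [DecidableEq α] (f : ℕ → α) (m : ℕ) :
    ((Finset.range (m+1)).image f).card ≤ 1 + ∑ k ∈ Finset.range m, if f k ≠ f (k+1) then 1 else 0 := by
  induction m with
  | zero => simp
  | succ m ih =>
    rw [Finset.range_add_one, Finset.image_insert, Finset.sum_range_succ]
    split_ifs with h
    · have := Finset.card_insert_le (f (m+1)) ((Finset.range (m+1)).image f)
      omega
    · push Not at h
      rw [Finset.insert_eq_of_mem]
      · omega
      · exact Finset.mem_image.2 ⟨m, by simp, h⟩

open Classical in
noncomputable def bct {n : ℕ} (A : Matrix (Fin n) (Fin n) ℝ) (v : Fin n → ℝ) : ℕ :=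
  1 + ∑ k ∈ Finset.range (n-1), if Cl A (SS v (k+1)) then 1 else 0

lemma block_cover {n : ℕ} (A : Matrix (Fin n) (Fin n) ℝ) (hsym : ∀ i j, A i j = A j i) (v : Fin n → ℝ) :
    ∃ F : Finset (Set ℝ), blockSet (UU A v) ⊆ (F : Set (Set ℝ)) ∧ F.card ≤ bct A v := by
  classical
  rcases Nat.eq_zero_or_pos n with h0 | h0
  · subst h0
    refine ⟨∅, ?_, by simp⟩
    rintro C ⟨a, ha, _⟩
    simp [UU] at ha
  obtain ⟨m, rfl⟩ : ∃ m, n = m + 1 := ⟨n - 1, by omega⟩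
  set U := UU A v with hU
  have hsub : ∀ i j, (A i j ≠ 0 ∨ i = j) → Set.uIcc (v i) (v j) ⊆ U := by
    intro i j h x hx
    simp only [hU, UU, Set.mem_iUnion]
    exact ⟨i, j, h, hx⟩
  have hconn : ∀ i j, (A i j ≠ 0 ∨ i = j) → ∀ a ∈ Set.uIcc (v i) (v j), ∀ b ∈ Set.uIcc (v i) (v j),
      connectedComponentIn U a = connectedComponentIn U b := by
    intro i j h a ha b hb
    apply connectedComponentIn_eq
    exact isPreconnected_uIcc.subset_connectedComponentIn ha (hsub i j h) hb
  set σ := Tuple.sort v with hσ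
  have hmono : Monotone (v ∘ σ) := Tuple.monotone_sort v
  let f : ℕ → Set ℝ := fun k => connectedComponentIn U (v (σ (Fin.ofNat (m+1) k)))
  refine ⟨(Finset.range (m+1)).image f, ?_, ?_⟩
  · rintro C ⟨a, ha, rfl⟩
    simp only [hU, UU, Set.mem_iUnion] at ha
    obtain ⟨i, j, h, hx⟩ := ha
    simp only [Finset.coe_image, Set.mem_image]
    refine ⟨(σ.symm i).val, Finset.mem_coe.2 (Finset.mem_range.2 (σ.symm i).isLt), ?_⟩
    simp only [f, Fin.ofNat_eq_cast, Fin.cast_val_eq_self, Equiv.apply_symm_apply]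
    exact hconn i j h _ Set.left_mem_uIcc _ hx
  · refine (card_image_range f m).trans ?_
    unfold bct
    rw [Nat.add_sub_cancel]
    gcongr with k hk
    have hk := Finset.mem_range.1 hk
    by_cases hcl : Cl A (SS v (k+1))
    · simp only [hcl, if_true]; split_ifs <;> simp
    · have : f k = f (k+1) := by
        simp only [Cl, not_forall] at hcl
        obtain ⟨i, hi, j, hij, hj⟩ := hcl
        simp only [SS, Finset.mem_filter, Finset.mem_univ, true_and, ← hσ] at hi hj
        have e1 : (Fin.ofNat (m+1) k).val = k := by
          simp [Fin.ofNat, Nat.mod_eq_of_lt (show k < m+1 by omega)]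
        have e2 : (Fin.ofNat (m+1) (k+1)).val = k+1 := by
          simp only [Fin.ofNat, Nat.mod_eq_of_lt (show k+1 < m+1 by omega)]
        have a1 := hmono (show σ.symm i ≤ Fin.ofNat (m+1) k by rw [Fin.le_def, e1]; omega)
        have a2 := hmono (show Fin.ofNat (m+1) k ≤ Fin.ofNat (m+1) (k+1) by rw [Fin.le_def, e1, e2]; omega)
        have a3 := hmono (show Fin.ofNat (m+1) (k+1) ≤ σ.symm j by rw [Fin.le_def, e2]; omega)
        simp only [Function.comp, Equiv.apply_symm_apply] at a1 a2 a3
        apply hconn i j (Or.inl hij)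
        · rw [Set.mem_uIcc]; left; exact ⟨a1, a2.trans a3⟩
        · rw [Set.mem_uIcc]; left; exact ⟨a1.trans a2, a3⟩
      simp [this]

lemma abs_le_VV {n : ℕ} (v : Fin n → ℝ) (i : Fin n) : |v i - mean v| ≤ √(VV v) := by
  apply Real.abs_le_sqrt
  exact Finset.single_le_sum (f := fun i => (v i - mean v)^2) (fun _ _ => sq_nonneg _) (Finset.mem_univ i)

lemma UU_subset {n : ℕ} (A : Matrix (Fin n) (Fin n) ℝ) (v : Fin n → ℝ) :
    UU A v ⊆ Set.Icc (mean v - √(VV v)) (mean v + √(VV v)) := by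
  have h : ∀ i, v i ∈ Set.Icc (mean v - √(VV v)) (mean v + √(VV v)) := by
    intro i
    have := abs_le.1 (abs_le_VV v i)
    constructor <;> linarith
  refine Set.iUnion_subset fun i => Set.iUnion_subset fun j => Set.iUnion_subset fun _ => ?_
  exact Set.ordConnected_Icc.uIcc_subset (h i) (h j)

lemma stepEnergy_le {n : ℕ} (A : Matrix (Fin n) (Fin n) ℝ) (hsym : ∀ i j, A i j = A j i) (v : Fin n → ℝ)
    {s : ℝ} (hs : 0 < s) (hs1 : s ≤ 1) :
    stepEnergy s (UU A v) ≤ bct A v * ENNReal.ofReal (2 * VV v ^ (s/2)) := by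
  obtain ⟨F, hF, hFc⟩ := block_cover A hsym v
  unfold stepEnergy
  have hb : ∀ C : blockSet (UU A v), ENNReal.ofReal (Metric.diam (C : Set ℝ) ^ s) ≤ ENNReal.ofReal (2 * VV v ^ (s/2)) := by
    rintro ⟨C, a, ha, rfl⟩
    apply ENNReal.ofReal_le_ofReal
    have h1 : Metric.diam (connectedComponentIn (UU A v) a) ≤ 2 * √(VV v) := by
      calc _ ≤ Metric.diam (Set.Icc (mean v - √(VV v)) (mean v + √(VV v))) :=
            Metric.diam_mono ((connectedComponentIn_subset _ _).trans (UU_subset A v)) (Metric.isBounded_Icc _ _)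
        _ = 2 * √(VV v) := by
            rw [Real.diam_Icc]
            · ring
            · linarith [Real.sqrt_nonneg (VV v)]
    calc _ ≤ (2 * √(VV v)) ^ s := Real.rpow_le_rpow Metric.diam_nonneg h1 hs.le
      _ = 2 ^ s * VV v ^ (s/2) := by
        rw [Real.mul_rpow (by norm_num) (Real.sqrt_nonneg _), Real.sqrt_eq_rpow, ← Real.rpow_mul (VV_nonneg v)]
        congr 2; ring
      _ ≤ 2 * VV v ^ (s/2) := by
        have : (2:ℝ) ^ s ≤ 2 := by
          calc (2:ℝ) ^ s ≤ 2 ^ (1:ℝ) := Real.rpow_le_rpow_of_exponent_le (by norm_num) hs1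
            _ = 2 := by simp
        have := Real.rpow_nonneg (VV_nonneg v) (s/2)
        gcongr
  calc _ ≤ ∑' _ : blockSet (UU A v), ENNReal.ofReal (2 * VV v ^ (s/2)) := ENNReal.tsum_le_tsum hb
    _ ≤ ∑' _ : (F : Set (Set ℝ)), ENNReal.ofReal (2 * VV v ^ (s/2)) := ENNReal.tsum_mono_subtype (fun _ => _) hF
    _ = F.card * ENNReal.ofReal (2 * VV v ^ (s/2)) := by
      rw [Finset.tsum_subtype' F (fun _ => ENNReal.ofReal (2 * VV v ^ (s/2)))]
      simp
    _ ≤ _ := by gcongr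

lemma geomSum_bd (m : ℕ) : ∑ k ∈ Finset.range m, (5/6:ℝ)^(k+1) ≤ 6 := by
  have : ∑ k ∈ Finset.range m, (5/6:ℝ)^(k+1) = 5 - 5 * (5/6)^m := by
    induction m with
    | zero => simp
    | succ m ih => rw [Finset.sum_range_succ, ih]; ring
  rw [this]
  have : (0:ℝ) ≤ (5/6)^m := by positivity
  linarith

lemma sum_bct {n d : ℕ} (hd : 3 < d) (v : Fin n → ℝ) :
    ∑ A ∈ RF n d, bct A v ≤ 13 * (RF n d).card := by
  classical
  have h1 : ∑ A ∈ RF n d, bct A v = (RF n d).card + ∑ k ∈ Finset.range (n-1), cnt n d (SS v (k+1)) := by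
    simp only [bct, cnt, Finset.sum_add_distrib, Finset.card_filter]
    rw [Finset.sum_comm]
    simp
  have h2 : (∑ k ∈ Finset.range (n-1), (cnt n d (SS v (k+1)) : ℝ)) ≤ 
      ∑ k ∈ Finset.range (n-1), (RF n d).card * ((5 / 6 : ℝ) ^ (k+1) + (5 / 6 : ℝ) ^ (n - 1 - 1 - k + 1)) := by
    refine Finset.sum_le_sum fun k hk => ?_
    have hk := Finset.mem_range.1 hk
    have := cnt_le hd (SS v (k+1))
    rw [SS_card v (k+1) (by omega)] at this
    rwa [show n - 1 - 1 - k + 1 = n - (k+1) by omega]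
  rw [← Finset.mul_sum, Finset.sum_add_distrib, Finset.sum_range_reflect (fun k => (5/6:ℝ)^(k+1))] at h2
  have h3 := geomSum_bd (n-1)
  have h4 : (∑ A ∈ RF n d, (bct A v : ℝ)) ≤ 13 * (RF n d).card := by
    have h1' : (∑ A ∈ RF n d, (bct A v : ℝ)) = (RF n d).card + ∑ k ∈ Finset.range (n-1), (cnt n d (SS v (k+1)) : ℝ) := by
      exact_mod_cast h1
    rw [h1']
    have : (0:ℝ) ≤ (RF n d).card := by positivity
    nlinarith
  exact_mod_cast h4

lemma avg_energy {n d : ℕ} (hd : 3 < d) (hne : (RF n d).Nonempty) (v : Fin n → ℝ)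
    {s : ℝ} (hs : 0 < s) (hs1 : s ≤ 1) :
    ((RF n d).card : ℝ≥0∞)⁻¹ * ∑ A ∈ RF n d, stepEnergy s (UU A v) ≤ 26 * ENNReal.ofReal (VV v ^ (s/2)) := by
  have hN : ((RF n d).card : ℝ≥0∞) ≠ 0 := by simpa using hne.ne_empty
  calc _ ≤ ((RF n d).card : ℝ≥0∞)⁻¹ * ∑ A ∈ RF n d, bct A v * ENNReal.ofReal (2 * VV v ^ (s/2)) := by
        gcongr with A hA
        exact stepEnergy_le A (mem_RF.1 hA).2.1 v hs hs1
    _ = ((RF n d).card : ℝ≥0∞)⁻¹ * ((∑ A ∈ RF n d, bct A v : ℕ) * ENNReal.ofReal (2 * VV v ^ (s/2))) := by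
        rw [← Finset.sum_mul]; push_cast; rfl
    _ ≤ ((RF n d).card : ℝ≥0∞)⁻¹ * ((13 * (RF n d).card : ℕ) * ENNReal.ofReal (2 * VV v ^ (s/2))) := by
        gcongr
        exact sum_bct hd v
    _ = (((RF n d).card : ℝ≥0∞)⁻¹ * (RF n d).card) * (13 * ENNReal.ofReal (2 * VV v ^ (s/2))) := by
        push_cast; ring
    _ = _ := by
        rw [ENNReal.inv_mul_cancel hN (by simp), one_mul, ENNReal.ofReal_mul (by norm_num), ← mul_assoc]
        norm_num

lemma avg_phi {n d : ℕ} (hd : 3 < d) (hne : (RF n d).Nonempty) (v : Fin n → ℝ)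
    {s : ℝ} (hs : 0 < s) (hs1 : s ≤ 1) :
    ((RF n d).card : ℝ≥0∞)⁻¹ * ∑ A ∈ RF n d, ENNReal.ofReal (VV (stp d v A) ^ (s/2))
      ≤ ENNReal.ofReal (((d:ℝ)⁻¹) ^ (s/2)) * ENNReal.ofReal (VV v ^ (s/2)) := by
  have hN : (0:ℝ) < (RF n d).card := by exact_mod_cast hne.card_pos
  rw [← ENNReal.ofReal_sum_of_nonneg (fun A _ => Real.rpow_nonneg (VV_nonneg _) _), ← ENNReal.ofReal_natCast,
    ← ENNReal.ofReal_inv_of_pos hN, ← ENNReal.ofReal_mul (by positivity), ← ENNReal.ofReal_mul (by positivity)]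
  apply ENNReal.ofReal_le_ofReal
  rw [mul_comm (((d:ℝ)⁻¹) ^ (s/2))]
  exact VV_jensen hd hne v (by linarith) (by linarith)

lemma nullMeas_fiber {Ω ι : Type*} [MeasurableSpace Ω] (μ : Measure Ω) [IsProbabilityMeasure μ] [Fintype ι]
    (g : Ω → ι) (h : ∑ i, μ (g ⁻¹' {i}) ≤ 1) (i : ι) : NullMeasurableSet (g ⁻¹' {i}) μ := by
  classical
  set H : ι → Set Ω := fun j => toMeasurable μ (g ⁻¹' {j}) with hH
  have hHm : ∀ j, MeasurableSet (H j) := fun j => measurableSet_toMeasurable _ _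
  have hHs : ∀ j, g ⁻¹' {j} ⊆ H j := fun j => subset_toMeasurable _ _
  have hHμ : ∀ j, μ (H j) = μ (g ⁻¹' {j}) := fun j => measure_toMeasurable _
  set K : Set Ω := ⋃ j ∈ Finset.univ.erase i, H j with hK
  have hKm : MeasurableSet K := Finset.measurableSet_biUnion _ (fun j _ => hHm j)
  have hun : H i ∪ K = Set.univ := by
    ext ω
    simp only [Set.mem_union, Set.mem_univ, iff_true]
    by_cases hω : g ω = i
    · left; exact hHs i hω
    · right
      simp only [hK, Set.mem_iUnion]
      exact ⟨g ω, by simp [hω], hHs _ rfl⟩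
  have h1 : μ (H i ∪ K) + μ (H i ∩ K) = μ (H i) + μ K := measure_union_add_inter _ hKm
  have h2 : μ K ≤ ∑ j ∈ Finset.univ.erase i, μ (H j) := measure_biUnion_finset_le _ _
  have h3 : μ (H i) + μ K ≤ 1 := by
    refine le_trans ?_ h
    rw [← Finset.add_sum_erase _ _ (Finset.mem_univ i), ← hHμ i]
    gcongr
    refine h2.trans (le_of_eq ?_)
    exact Finset.sum_congr rfl fun j _ => hHμ j
  rw [← h1, hun, measure_univ] at h3
  have h4 : μ (H i ∩ K) = 0 := by
    by_contra hne
    exact absurd h3 (not_le.2 (ENNReal.lt_add_right ENNReal.one_ne_top hne))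
  have h5 : μ (H i \ g ⁻¹' {i}) = 0 := by
    refine measure_mono_null ?_ h4
    rintro ω ⟨ha, hb⟩
    refine ⟨ha, ?_⟩
    simp only [hK, Set.mem_iUnion]
    exact ⟨g ω, by simpa using hb, hHs _ rfl⟩
  refine ⟨H i, hHm i, ?_⟩
  refine Filter.EventuallyLE.antisymm (Filter.Eventually.of_forall (hHs i)) ?_
  exact ae_le_set.2 h5

lemma lint_fiber {Ω ι : Type*} [MeasurableSpace Ω] (μ : Measure Ω) [IsProbabilityMeasure μ] [Fintype ι]
    (g : Ω → ι) (c : ℝ≥0∞) (hc : ∀ i, μ (g ⁻¹' {i}) = c) (h : Fintype.card ι * c ≤ 1) (f : ι → ℝ≥0∞) :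
    AEMeasurable (fun ω => f (g ω)) μ ∧ ∫⁻ ω, f (g ω) ∂μ = c * ∑ i, f i := by
  have hn := nullMeas_fiber μ g (by simpa [hc] using h)
  letI : MeasurableSpace ι := ⊤
  have hg : AEMeasurable g μ := by
    apply NullMeasurable.aemeasurable
    intro S _
    have : g ⁻¹' S = ⋃ i ∈ S, g ⁻¹' {i} := by ext; simp
    rw [this]
    exact NullMeasurableSet.biUnion (Set.to_countable S) (fun i _ => hn i)
  refine ⟨(measurable_from_top (f := f)).comp_aemeasurable hg, ?_⟩
  rw [← lintegral_map' (f := f) measurable_from_top.aemeasurable hg, lintegral_fintype, Finset.mul_sum]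
  refine Finset.sum_congr rfl fun i _ => ?_
  rw [Measure.map_apply_of_aemeasurable hg (MeasurableSpace.measurableSet_top), hc, mul_comm]

lemma lint_step {n d : ℕ} {Ω : Type} [MeasurableSpace Ω] (μ : Measure Ω) [IsProbabilityMeasure μ]
    (hne : (RF n d).Nonempty)
    (G : ℕ → Ω → Matrix (Fin n) (Fin n) ℝ) (hG : ∀ t ω, G t ω ∈ RegAdj n d)
    (hu : ∀ (t : ℕ) (A : Matrix (Fin n) (Fin n) ℝ), A ∈ RegAdj n d →
              μ {ω | G t ω = A} = (((RegAdj n d).ncard : ℝ≥0∞))⁻¹)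
    (hi : ∀ (T : Finset ℕ) (A : ℕ → Matrix (Fin n) (Fin n) ℝ),
              μ {ω | ∀ t ∈ T, G t ω = A t} = ∏ t ∈ T, μ {ω | G t ω = A t})
    (x : ℕ → Ω → Fin n → ℝ) (x₀ : Fin n → ℝ) (hx0 : ∀ ω, x 0 ω = x₀)
    (hx : ∀ t ω, x (t + 1) ω = stp d (x t ω) (G t ω)) (t : ℕ) 
    (h : (Fin n → ℝ) → Matrix (Fin n) (Fin n) ℝ → ℝ≥0∞) :
    AEMeasurable (fun ω => h (x t ω) (G t ω)) μ ∧
    ∫⁻ ω, h (x t ω) (G t ω) ∂μ = ∫⁻ ω, ((RF n d).card : ℝ≥0∞)⁻¹ * ∑ A ∈ RF n d, h (x t ω) A ∂μ := by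
  classical
  have hN : ((RF n d).card : ℝ≥0∞) ≠ 0 := by simpa using hne.ne_empty
  have hcard : (RegAdj n d).ncard = (RF n d).card := Set.ncard_eq_toFinset_card _ (regAdj_finite n d)
  let γ : (t : ℕ) → Ω → (Fin t → RF n d) := fun t ω i => ⟨G i ω, mem_RF.2 (hG i ω)⟩
  have hγ : ∀ t A, μ (γ t ⁻¹' {A}) = (((RF n d).card : ℝ≥0∞)⁻¹) ^ t := by
    intro t A
    let A' : ℕ → Matrix (Fin n) (Fin n) ℝ := fun i => if h : i < t then (A ⟨i, h⟩).1 else 0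
    have : γ t ⁻¹' {A} = {ω | ∀ i ∈ Finset.range t, G i ω = A' i} := by
      ext ω
      simp only [Set.mem_preimage, Set.mem_singleton_iff, Set.mem_ofPred_eq, Finset.mem_range, funext_iff]
      constructor
      · intro h i hi
        simp only [A', hi, dif_pos]
        rw [← h ⟨i, hi⟩]
      · intro h i
        apply Subtype.ext
        have := h i.1 i.2
        simp only [A', i.2, dif_pos] at this
        exact this
    rw [this, hi, Finset.prod_congr rfl (g := fun _ => ((RF n d).card : ℝ≥0∞)⁻¹)]
    · simp
    · intro i hi
      have hi := Finset.mem_range.1 hi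
      rw [hu, hcard]
      simp only [A', hi, dif_pos]
      exact mem_RF.1 (A ⟨i, hi⟩).2
  have hL : ∀ t (f : (Fin t → RF n d) → ℝ≥0∞), AEMeasurable (fun ω => f (γ t ω)) μ ∧ 
      ∫⁻ ω, f (γ t ω) ∂μ = (((RF n d).card : ℝ≥0∞)⁻¹) ^ t * ∑ A, f A := by
    intro t f
    refine lint_fiber μ (γ t) _ (hγ t) ?_ f
    simp only [Fintype.card_fun, Fintype.card_coe, Fintype.card_fin]
    push_cast
    rw [← mul_pow, ENNReal.mul_inv_cancel hN (by simp), one_pow]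
  have hX : ∀ t, ∃ X : (Fin t → RF n d) → (Fin n → ℝ), ∀ ω, x t ω = X (γ t ω) := by
    intro t
    induction t with
    | zero => exact ⟨fun _ => x₀, hx0⟩
    | succ t ih =>
      obtain ⟨X, hX⟩ := ih
      refine ⟨fun A => stp d (X (Fin.init A)) (A (Fin.last t)).1, fun ω => ?_⟩
      rw [hx, hX]
      rfl
  obtain ⟨X, hX⟩ := hX t
  obtain ⟨f1, hf1⟩ : ∃ f1 : (Fin (t+1) → RF n d) → ℝ≥0∞,
      f1 = fun A => h (X (Fin.init A)) (A (Fin.last t)).1 := ⟨_, rfl⟩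
  have e1 : ∀ ω, h (x t ω) (G t ω) = f1 (γ (t+1) ω) := by
    intro ω
    rw [hX, hf1]
    rfl
  obtain ⟨f2, hf2⟩ : ∃ f2 : (Fin t → RF n d) → ℝ≥0∞,
      f2 = fun B => ((RF n d).card : ℝ≥0∞)⁻¹ * ∑ A ∈ RF n d, h (X B) A := ⟨_, rfl⟩
  have e2 : ∀ ω, ((RF n d).card : ℝ≥0∞)⁻¹ * ∑ A ∈ RF n d, h (x t ω) A = f2 (γ t ω) := by
    intro ω
    rw [hX, hf2]
  simp only [e1]
  refine ⟨(hL (t+1) f1).1, ?_⟩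
  rw [(hL (t+1) f1).2]
  simp only [e2]
  rw [(hL t f2).2, hf1, hf2, ← (Fin.snocEquiv (fun _ : Fin (t+1) => {A // A ∈ RF n d})).sum_comp, Fintype.sum_prod_type_right,
    ← Finset.mul_sum, pow_succ, mul_assoc]
  congr 2
  refine Finset.sum_congr rfl fun B _ => ?_
  have e3 : ∀ a : {A // A ∈ RF n d}, Fin.init ((Fin.snocEquiv (fun _ : Fin (t+1) => {A // A ∈ RF n d})) (a, B)) = B :=
    fun a => Fin.init_snoc (α := fun _ : Fin (t+1) => {A // A ∈ RF n d}) a B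
  simp only [e3, Fin.snocEquiv_apply, Fin.snoc_last]
  exact Finset.sum_coe_sort (RF n d) (fun A => h (X B) A)

lemma final_sum {d : ℕ} (hd : 3 < d) {s : ℝ} (hs : 0 < s) (hs1 : s ≤ 1) :
    ∑' t : ℕ, 26 * ENNReal.ofReal (((d:ℝ)⁻¹) ^ (s/2)) ^ t ≤ ENNReal.ofReal (52 / s) := by
  have hd' : (4:ℝ) ≤ d := by exact_mod_cast hd
  set q := ((d:ℝ)⁻¹) ^ (s/2) with hq
  have hq0 : 0 ≤ q := by positivity
  have hq1 : q ≤ 1 - s/2 := by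
    calc q ≤ ((4:ℝ)⁻¹) ^ (s/2) := by
          apply Real.rpow_le_rpow (by positivity) _ (by linarith)
          exact inv_anti₀ (by norm_num) hd'
      _ = (1 + (-(1/2:ℝ))) ^ s := by
          rw [show (4:ℝ)⁻¹ = (1 + (-(1/2:ℝ))) ^ (2:ℝ) by norm_num, ← Real.rpow_mul (by norm_num)]
          congr 1; ring
      _ ≤ 1 + s * (-(1/2)) := rpow_one_add_le_one_add_mul_self (by norm_num) hs.le hs1
      _ = _ := by ring
  have hpos : 0 < 1 - q := by linarith
  rw [ENNReal.tsum_mul_left, ENNReal.tsum_geometric, ← ENNReal.ofReal_one, ← ENNReal.ofReal_sub _ hq0,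
    ← ENNReal.ofReal_inv_of_pos hpos, show (26:ℝ≥0∞) = ENNReal.ofReal 26 by simp, ← ENNReal.ofReal_mul (by norm_num)]
  apply ENNReal.ofReal_le_ofReal
  rw [← div_eq_mul_inv, div_le_div_iff₀ hpos hs]
  linarith

/-- For every fixed `d > 3` there is a constant `c > 0` (depending only
on `d`) such that for every `n` (such that simple `(d-1)`-regular graphs on `n` vertices
exist), every `s ∈ (0,1]`, and every initial condition of scaled variance at most `1`,
the expected `s`-energy of a random averaging system — where at each time `t` the graph
`G t` is an independent uniformly random simple `(d-1)`-regular graph with self-loops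
added, and `P t = (1/d)·M t` for `M t` the adjacency matrix with self-loops —
satisfies `𝔼 𝓔^ran_s ≤ c/s`. -/
theorem ranSEnergy_le (d : ℕ) (hd : 3 < d) :
    ∃ c : ℝ, 0 < c ∧
      ∀ n : ℕ, (RegAdj n d).Nonempty →
        ∀ (Ω : Type) (mΩ : MeasurableSpace Ω) (μ : Measure Ω), IsProbabilityMeasure μ →
          ∀ G : ℕ → Ω → Matrix (Fin n) (Fin n) ℝ,
            (∀ t ω, G t ω ∈ RegAdj n d) →
            -- each `G t` is uniformly distributed on `RegAdj n d`
            (∀ (t : ℕ) (A : Matrix (Fin n) (Fin n) ℝ), A ∈ RegAdj n d →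
              μ {ω | G t ω = A} = (((RegAdj n d).ncard : ℝ≥0∞))⁻¹) →
            -- the graphs at distinct times are independent
            (∀ (T : Finset ℕ) (A : ℕ → Matrix (Fin n) (Fin n) ℝ),
              μ {ω | ∀ t ∈ T, G t ω = A t} = ∏ t ∈ T, μ {ω | G t ω = A t}) →
            ∀ (x : ℕ → Ω → Fin n → ℝ) (x₀ : Fin n → ℝ),
              (∀ ω, x 0 ω = x₀) →
              (d : ℝ) * ∑ i, (x₀ i - (∑ j, x₀ j) / n) ^ 2 ≤ 1 →
              (∀ t ω i, x (t + 1) ω i =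
                (1 / (d : ℝ)) * (x t ω i + ∑ j, G t ω i j * x t ω j)) →
              ∀ s : ℝ, 0 < s → s ≤ 1 →
                ∫⁻ ω, ∑' t : ℕ,
                    stepEnergy s
                      (⋃ (i : Fin n) (j : Fin n) (_ : G t ω i j ≠ 0 ∨ i = j),
                        Set.uIcc (x t ω i) (x t ω j)) ∂μ ≤
                  ENNReal.ofReal (c / s) := by
  refine ⟨52, by norm_num, ?_⟩
  intro n hne Ω mΩ μ hμ G hG hu hi x x₀ hx0 hv hx s hs hs1
  have hne' : (RF n d).Nonempty := by
    obtain ⟨A, hA⟩ := hne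
    exact ⟨A, mem_RF.2 hA⟩
  have hx' : ∀ t ω, x (t + 1) ω = stp d (x t ω) (G t ω) := fun t ω => funext fun i => hx t ω i
  have key := lint_step μ hne' G hG hu hi x x₀ hx0 hx'
  have hΦ : ∀ t, ∫⁻ ω, ENNReal.ofReal (VV (x t ω) ^ (s/2)) ∂μ ≤ ENNReal.ofReal (((d:ℝ)⁻¹) ^ (s/2)) ^ t := by
    intro t
    induction t with
    | zero =>
      simp only [hx0, lintegral_const, measure_univ, mul_one, pow_zero]
      rw [← ENNReal.ofReal_one]
      apply ENNReal.ofReal_le_ofReal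
      apply Real.rpow_le_one (VV_nonneg _) _ (by linarith)
      have hv' : (d:ℝ) * VV x₀ ≤ 1 := hv
      have h3 : (3:ℝ) < d := by exact_mod_cast hd
      nlinarith [VV_nonneg x₀]
    | succ t ih =>
      simp only [hx']
      rw [(key t (fun v A => ENNReal.ofReal (VV (stp d v A) ^ (s/2)))).2, pow_succ']
      calc _ ≤ ∫⁻ ω, ENNReal.ofReal (((d:ℝ)⁻¹) ^ (s/2)) * ENNReal.ofReal (VV (x t ω) ^ (s/2)) ∂μ :=
            lintegral_mono fun ω => avg_phi hd hne' (x t ω) hs hs1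
        _ = ENNReal.ofReal (((d:ℝ)⁻¹) ^ (s/2)) * ∫⁻ ω, ENNReal.ofReal (VV (x t ω) ^ (s/2)) ∂μ :=
            lintegral_const_mul' _ _ ENNReal.ofReal_ne_top
        _ ≤ _ := by gcongr
  have hE : ∀ t, ∫⁻ ω, stepEnergy s (UU (G t ω) (x t ω)) ∂μ ≤ 26 * ENNReal.ofReal (((d:ℝ)⁻¹) ^ (s/2)) ^ t := by
    intro t
    rw [(key t (fun v A => stepEnergy s (UU A v))).2]
    calc _ ≤ ∫⁻ ω, 26 * ENNReal.ofReal (VV (x t ω) ^ (s/2)) ∂μ :=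
            lintegral_mono fun ω => avg_energy hd hne' (x t ω) hs hs1
      _ = 26 * ∫⁻ ω, ENNReal.ofReal (VV (x t ω) ^ (s/2)) ∂μ :=
            lintegral_const_mul' _ _ (by norm_num)
      _ ≤ _ := by gcongr; exact hΦ t
  change ∫⁻ ω, ∑' t : ℕ, stepEnergy s (UU (G t ω) (x t ω)) ∂μ ≤ _
  rw [lintegral_tsum fun t => (key t (fun v A => stepEnergy s (UU A v))).1]
  exact (ENNReal.tsum_le_tsum hE).trans (final_sum hd hs hs1)
end
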